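/- arXiv:2303.10658 — 2 statements merged into one kernel-verified Lean document; each statement's English description precedes it below -/
import Mathlib

section
/- Let {F^{ij} : 1 ≤ i < j ≤ 4} be six fundamental matrices with epipoles e_j^i such that: e₁² is parallel to e₁³ but not to e₁⁴; e₂¹ is parallel to e₂³ but not to e₂⁴; e₃¹ is parallel to e₃² but not to e₃⁴; and e₄¹, e₄², e₄³ are pairwise non-parallel and span a 2-dimensional subspace of ℝ³. Then {F^{ij}} is compatible if and only if each of the four sub-triples {F^{ij},F^{ik},F^{jk}} (1 ≤ i < j < k ≤ 4) is compatible. -/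
open Matrix

/-- The 6×6 matrix whose first three rows form the block `[P₁ | x | 0]` and whose last
three rows form the block `[P₂ | 0 | y]`. -/
noncomputable def bigMat (P₁ P₂ : Matrix (Fin 3) (Fin 4) ℝ) (x y : Fin 3 → ℝ) :
    Matrix (Fin 6) (Fin 6) ℝ :=
  fun i j =>
    if hi : (i : ℕ) < 3 then
      if hj : (j : ℕ) < 4 then P₁ ⟨(i : ℕ), hi⟩ ⟨(j : ℕ), hj⟩
      else if (j : ℕ) = 4 then x ⟨(i : ℕ), hi⟩ else 0
    else
      if hj : (j : ℕ) < 4 then P₂ ⟨(i : ℕ) - 3, by have := i.isLt; omega⟩ ⟨(j : ℕ), hj⟩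
      else if (j : ℕ) = 4 then 0
      else y ⟨(i : ℕ) - 3, by have := i.isLt; omega⟩

/-- `psi P₁ P₂` is the unique 3×3 matrix `F` such that for all `x y : ℝ³`,
`xᵀ F y = det [P₁ | x | 0; P₂ | 0 | y]`.  (Since the determinant is bilinear in `(x, y)`,
this matrix is obtained by evaluating at pairs of standard basis vectors.) -/
noncomputable def psi (P₁ P₂ : Matrix (Fin 3) (Fin 4) ℝ) : Matrix (Fin 3) (Fin 3) ℝ :=
  fun a b => (bigMat P₁ P₂ (Pi.single a 1) (Pi.single b 1)).det

/-- A camera is a real 3×4 matrix of rank 3. -/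
def IsCamera (P : Matrix (Fin 3) (Fin 4) ℝ) : Prop := P.rank = 3

/-- A triple of matrices `{F¹², F¹³, F²³}` is compatible. -/
def Compat3 (F12 F13 F23 : Matrix (Fin 3) (Fin 3) ℝ) : Prop :=
  ∃ (P₁ P₂ P₃ : Matrix (Fin 3) (Fin 4) ℝ) (l12 l13 l23 : ℝ),
    IsCamera P₁ ∧ IsCamera P₂ ∧ IsCamera P₃ ∧
    l12 ≠ 0 ∧ l13 ≠ 0 ∧ l23 ≠ 0 ∧
    l12 • F12 = psi P₁ P₂ ∧ l13 • F13 = psi P₁ P₃ ∧ l23 • F23 = psi P₂ P₃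

/-- The six fundamental matrices `{F i j : i < j}` (on four views) are compatible. -/
def Compat4 (F : Fin 4 → Fin 4 → Matrix (Fin 3) (Fin 3) ℝ) : Prop :=
  ∃ (P : Fin 4 → Matrix (Fin 3) (Fin 4) ℝ) (lam : Fin 4 → Fin 4 → ℝ),
    (∀ i, IsCamera (P i)) ∧
      ∀ i j, i < j → lam i j ≠ 0 ∧ lam i j • F i j = psi (P i) (P j)

theorem det4 (p q r s : Fin 4 → ℝ) : (Matrix.of ![p, q, r, s]).det =
    p 0 * (q 1 * (r 2 * s 3 - r 3 * s 2) - q 2 * (r 1 * s 3 - r 3 * s 1) + q 3 * (r 1 * s 2 - r 2 * s 1))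
    - p 1 * (q 0 * (r 2 * s 3 - r 3 * s 2) - q 2 * (r 0 * s 3 - r 3 * s 0) + q 3 * (r 0 * s 2 - r 2 * s 0))
    + p 2 * (q 0 * (r 1 * s 3 - r 3 * s 1) - q 1 * (r 0 * s 3 - r 3 * s 0) + q 3 * (r 0 * s 1 - r 1 * s 0))
    - p 3 * (q 0 * (r 1 * s 2 - r 2 * s 1) - q 1 * (r 0 * s 2 - r 2 * s 0) + q 2 * (r 0 * s 1 - r 1 * s 0)) := by
  simp [Matrix.det_succ_row_zero, Fin.sum_univ_succ, Fin.succAbove]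
  ring

theorem det_col_single {n : ℕ} (A : Matrix (Fin (n+1)) (Fin (n+1)) ℝ) (k : Fin (n+1))
    (h : ∀ i, A i (Fin.last n) = if i = k then 1 else 0) :
    A.det = (-1) ^ ((k : ℕ) + n) * (A.submatrix k.succAbove Fin.castSucc).det := by
  rw [Matrix.det_succ_column A (Fin.last n), Finset.sum_eq_single k]
  · simp [h]
  · intro b _ hb
    simp [h, hb]
  · simp

theorem bigMat_det (P Q : Matrix (Fin 3) (Fin 4) ℝ) (a b : Fin 3) (k : Fin 6) (m : Fin 5)
    (hk : (k : ℕ) = b + 3) (hm : (m : ℕ) = a) :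
    psi P Q a b = (-1) ^ ((b : ℕ) + a) *
      (((bigMat P Q (Pi.single a 1) (Pi.single b 1)).submatrix k.succAbove
        Fin.castSucc).submatrix m.succAbove Fin.castSucc).det := by
  unfold psi
  rw [det_col_single _ k, det_col_single (Matrix.submatrix _ _ _) m]
  · rw [← mul_assoc, ← pow_add, hk, hm]
    congr 1
    rw [show (b : ℕ) + 3 + 5 + (a + 4) = (b + a) + 2 * 6 by ring, pow_add, pow_mul]
    simp
  · obtain rfl : k = ⟨b + 3, Nat.add_lt_add_right b.2 3⟩ := Fin.ext hk
    obtain rfl : m = ⟨a, a.2.trans (by norm_num)⟩ := Fin.ext hm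
    fin_cases b <;> fin_cases a <;> intro i <;> fin_cases i <;>
      simp [bigMat, Fin.succAbove]
  · obtain rfl : k = ⟨b + 3, Nat.add_lt_add_right b.2 3⟩ := Fin.ext hk
    fin_cases b <;> intro i <;> fin_cases i <;> simp [bigMat]

theorem psi_eq (P Q : Matrix (Fin 3) (Fin 4) ℝ) (a b : Fin 3) :
    psi P Q a b = (Matrix.of ![P (a+1), P (a+2), Q (b+1), Q (b+2)]).det := by
  have h2 : ∀ (x y : Fin 3 → ℝ) (k : Fin 6) (m : Fin 5) (p q r s : Fin 4 → ℝ),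
      (∀ j, bigMat P Q x y (k.succAbove (m.succAbove 0)) j.castSucc.castSucc = p j) →
      (∀ j, bigMat P Q x y (k.succAbove (m.succAbove 1)) j.castSucc.castSucc = q j) →
      (∀ j, bigMat P Q x y (k.succAbove (m.succAbove 2)) j.castSucc.castSucc = r j) →
      (∀ j, bigMat P Q x y (k.succAbove (m.succAbove 3)) j.castSucc.castSucc = s j) →
      (((bigMat P Q x y).submatrix k.succAbove
        Fin.castSucc).submatrix m.succAbove Fin.castSucc) = Matrix.of ![p, q, r, s] := by
    intro x y k m p q r s h0 h1 h2 h3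
    ext i j
    fin_cases i
    · exact h0 j
    · exact h1 j
    · exact h2 j
    · exact h3 j
  rw [bigMat_det P Q a b ⟨b + 3, by omega⟩ ⟨a, by omega⟩ rfl rfl]
  rw [h2 _ _ _ _ (P (if a = 0 then 1 else 0)) (P (if a = 2 then 1 else 2))
    (Q (if b = 0 then 1 else 0)) (Q (if b = 2 then 1 else 2))]
  · rw [det4, det4]
    fin_cases a <;> fin_cases b <;> simp <;> ring
  all_goals
    fin_cases a <;> fin_cases b <;> intro j <;> fin_cases j <;> rfl

/-- the camera centre, as signed minors -/
def cen (P : Matrix (Fin 3) (Fin 4) ℝ) : Fin 4 → ℝ :=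
  fun j => (Matrix.of ![Pi.single j 1, P 0, P 1, P 2]).det

theorem ker_line {m n : ℕ} (M : Matrix (Fin m) (Fin n) ℝ) (h : M.rank + 1 = n)
    {x y : Fin n → ℝ} (hx0 : x ≠ 0) (hx : M *ᵥ x = 0) (hy : M *ᵥ y = 0) : ∃ k : ℝ, y = k • x := by
  have h1 := LinearMap.finrank_range_add_finrank_ker M.mulVecLin
  have h2 : Module.finrank ℝ (LinearMap.ker M.mulVecLin) = 1 := by
    have : Module.finrank ℝ (LinearMap.range M.mulVecLin) = M.rank := rfl
    simp at h1
    omega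
  obtain ⟨k, hk⟩ := (finrank_eq_one_iff_of_nonzero' (⟨x, by simpa using hx⟩ :
    LinearMap.ker M.mulVecLin) (by simpa [Subtype.ext_iff] using hx0)).1 h2
      ⟨y, by simpa using hy⟩
  exact ⟨k, by simpa using (congrArg Subtype.val hk).symm⟩

theorem mul_cen (P : Matrix (Fin 3) (Fin 4) ℝ) : P *ᵥ cen P = 0 := by
  ext i
  fin_cases i <;>
  · simp [cen, Matrix.mulVec, dotProduct, Fin.sum_univ_succ, Matrix.det_succ_row_zero,
      Fin.succAbove, Pi.single_apply]
    ring

theorem det_cen (P : Matrix (Fin 3) (Fin 4) ℝ) (r : Fin 4 → ℝ) :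
    (Matrix.of ![r, P 0, P 1, P 2]).det = r ⬝ᵥ cen P := by
  simp [cen, dotProduct, Fin.sum_univ_succ, Matrix.det_succ_row_zero,
      Fin.succAbove, Pi.single_apply]
  ring

theorem cen_ne (P : Matrix (Fin 3) (Fin 4) ℝ) (h : IsCamera P) : cen P ≠ 0 := by
  intro hc
  have hex : ∃ k : Fin 4 → ℝ, k ≠ 0 ∧ P *ᵥ k = 0 := by
    by_contra hne
    push Not at hne
    have hinj : Function.Injective P.mulVecLin := by
      rw [← LinearMap.ker_eq_bot, LinearMap.ker_eq_bot']
      intro m hm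
      by_contra h0
      exact hne m h0 (by simpa using hm)
    have := LinearMap.finrank_le_finrank_of_injective hinj
    simp at this
  obtain ⟨k, hk0, hk⟩ := hex
  have hd : (Matrix.of ![k, P 0, P 1, P 2]).det = 0 := by rw [det_cen, hc, dotProduct_zero]
  obtain ⟨x, hx0, hx⟩ := Matrix.exists_mulVec_eq_zero_iff.2 hd
  have hPx : P *ᵥ x = 0 := by
    ext i
    fin_cases i
    · simpa [Matrix.mulVec] using congrFun hx 1
    · simpa [Matrix.mulVec] using congrFun hx 2
    · simpa [Matrix.mulVec] using congrFun hx 3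
  obtain ⟨m, rfl⟩ := ker_line P (by rw [h]) hk0 hk hPx
  have h0 : k ⬝ᵥ (m • k) = 0 := by simpa [Matrix.mulVec] using congrFun hx 0
  rw [dotProduct_smul, smul_eq_mul, mul_eq_zero] at h0
  rcases h0 with h0 | h0
  · simp [h0] at hx0
  · exact hk0 (dotProduct_self_eq_zero.1 h0)

/-- cross product matrix (up to sign) -/
def cr (e : Fin 3 → ℝ) : Matrix (Fin 3) (Fin 3) ℝ :=
  !![0, -e 2, e 1; e 2, 0, -e 0; -e 1, e 0, 0]

theorem cr_self (e : Fin 3 → ℝ) : cr e *ᵥ e = 0 := by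
  ext i
  fin_cases i <;> simp [cr, Matrix.mulVec, dotProduct, Fin.sum_univ_succ] <;> ring

theorem cr_smul (s : ℝ) (e : Fin 3 → ℝ) : cr (s • e) = s • cr e := by
  ext i j
  fin_cases i <;> fin_cases j <;> simp [cr]

theorem cen_eq (P : Matrix (Fin 3) (Fin 4) ℝ) (j : Fin 4) :
    cen P j = (Matrix.of ![Pi.single j 1, P 0, P 1, P 2]).det := rfl

theorem main_id (P Q : Matrix (Fin 3) (Fin 4) ℝ) :
    Pᵀ * psi P Q = - (Qᵀ * cr (Q *ᵥ cen P)) := by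
  have h : ∀ a, (Q *ᵥ cen P) a = (Matrix.of ![Q a, P 0, P 1, P 2]).det := by
    intro a
    rw [det_cen]; rfl
  ext i j
  rw [Matrix.mul_apply, Matrix.neg_apply, Matrix.mul_apply, Fin.sum_univ_three,
    Fin.sum_univ_three]
  simp only [psi_eq, cr, h, det4, Matrix.transpose_apply]
  fin_cases j <;> simp [det4] <;> fin_cases i <;> simp <;> ring

theorem psi_smul (t : ℝ) (P Q : Matrix (Fin 3) (Fin 4) ℝ) :
    psi (t • P) Q = t ^ 2 • psi P Q := by
  ext a b
  rw [Matrix.smul_apply]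
  simp only [psi_eq, det4, Matrix.smul_apply, Pi.smul_apply, smul_eq_mul]
  ring

theorem psi_transpose (P Q : Matrix (Fin 3) (Fin 4) ℝ) : (psi P Q)ᵀ = psi Q P := by
  ext a b
  rw [Matrix.transpose_apply]
  simp only [psi_eq, det4]
  ring

theorem psi_mul (P Q : Matrix (Fin 3) (Fin 4) ℝ) (H : Matrix (Fin 4) (Fin 4) ℝ) :
    psi (P * H) (Q * H) = H.det • psi P Q := by
  ext a b
  rw [Matrix.smul_apply, psi_eq, psi_eq, smul_eq_mul, mul_comm, ← Matrix.det_mul]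
  congr 1
  ext i j
  fin_cases i <;> simp [Matrix.mul_apply]

theorem cam_rightInv (P : Matrix (Fin 3) (Fin 4) ℝ) (h : IsCamera P) :
    ∃ R : Matrix (Fin 4) (Fin 3) ℝ, P * R = 1 := by
  have hs : Function.Surjective P.mulVec := by
    have : LinearMap.range P.mulVecLin = ⊤ := by
      apply Submodule.eq_top_of_finrank_eq
      rw [show Module.finrank ℝ (LinearMap.range P.mulVecLin) = P.rank from rfl, h]
      simp
    exact LinearMap.range_eq_top.1 this
  exact Matrix.mulVec_surjective_iff_exists_right_inverse.1 hs

theorem transpose_cancel {n : ℕ} (P : Matrix (Fin 3) (Fin 4) ℝ) (h : IsCamera P)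
    {X Y : Matrix (Fin 3) (Fin n) ℝ} (hXY : Pᵀ * X = Pᵀ * Y) : X = Y := by
  obtain ⟨R, hR⟩ := cam_rightInv P h
  have h1 : Rᵀ * Pᵀ = 1 := by rw [← Matrix.transpose_mul, hR, Matrix.transpose_one]
  have := congrArg (Rᵀ * ·) hXY
  simpa [← Matrix.mul_assoc, h1] using this

theorem cr_zero : cr 0 = 0 := by
  ext i j
  fin_cases i <;> fin_cases j <;> simp [cr]

theorem epi_ne {P Q : Matrix (Fin 3) (Fin 4) ℝ} (hP : IsCamera P) (h : psi P Q ≠ 0) :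
    Q *ᵥ cen P ≠ 0 := by
  intro h0
  apply h
  apply transpose_cancel P hP
  rw [main_id, h0, cr_zero]
  simp

theorem psi_epi {P Q : Matrix (Fin 3) (Fin 4) ℝ} (hP : IsCamera P) :
    psi P Q *ᵥ (Q *ᵥ cen P) = 0 := by
  obtain ⟨R, hR⟩ := cam_rightInv P hP
  have h1 : Rᵀ * Pᵀ = 1 := by rw [← Matrix.transpose_mul, hR, Matrix.transpose_one]
  have h2 : psi P Q = Rᵀ * (Pᵀ * psi P Q) := by rw [← Matrix.mul_assoc, h1, Matrix.one_mul]
  rw [h2, main_id, ← Matrix.mulVec_mulVec, Matrix.neg_mulVec, ← Matrix.mulVec_mulVec, cr_self]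
  simp

theorem ne_of_rank {M : Matrix (Fin 3) (Fin 3) ℝ} (h : M.rank = 2) : M ≠ 0 := by
  rintro rfl
  simp at h

theorem psi_ker {P Q : Matrix (Fin 3) (Fin 4) ℝ} (hP : IsCamera P) (h : (psi P Q).rank = 2)
    {y : Fin 3 → ℝ} (hy : psi P Q *ᵥ y = 0) : ∃ k : ℝ, y = k • (Q *ᵥ cen P) :=
  ker_line _ (by rw [h]) (epi_ne hP (ne_of_rank h)) (psi_epi hP) hy

theorem cam_ker {P : Matrix (Fin 3) (Fin 4) ℝ} (hP : IsCamera P)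
    {y : Fin 4 → ℝ} (hy : P *ᵥ y = 0) : ∃ k : ℝ, y = k • cen P :=
  ker_line _ (by rw [hP]) (cen_ne P hP) (mul_cen P) hy

/-- columns version of a rank one factorisation -/
theorem cols_factor {m n : ℕ} (M : Matrix (Fin m) (Fin n) ℝ) (c : Fin m → ℝ)
    (h : ∀ x, ∃ k : ℝ, M *ᵥ x = k • c) : ∃ d : Fin n → ℝ, M = Matrix.vecMulVec c d := by
  choose k hk using h
  refine ⟨fun j => k (Pi.single j 1), ?_⟩
  ext i j
  have := congrFun (hk (Pi.single j 1)) i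
  simp at this
  rw [this, Matrix.vecMulVec_apply, mul_comm]

theorem cr_ker {e y : Fin 3 → ℝ} (he : e ≠ 0) (h : cr e *ᵥ y = 0) : ∃ k : ℝ, y = k • e := by
  have h0 : -(e 2 * y 1) + e 1 * y 2 = 0 := by
    simpa [cr, Matrix.mulVec, dotProduct, Fin.sum_univ_succ] using congrFun h 0
  have h1 : e 2 * y 0 + -(e 0 * y 2) = 0 := by
    simpa [cr, Matrix.mulVec, dotProduct, Fin.sum_univ_succ] using congrFun h 1
  have h2 : -(e 1 * y 0) + e 0 * y 1 = 0 := by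
    simpa [cr, Matrix.mulVec, dotProduct, Fin.sum_univ_succ] using congrFun h 2
  by_cases c0 : e 0 = 0
  · by_cases c1 : e 1 = 0
    · have c2 : e 2 ≠ 0 := by
        intro c2
        apply he
        ext i
        fin_cases i <;> simp [c0, c1, c2]
      refine ⟨y 2 / e 2, ?_⟩
      ext i
      fin_cases i <;> simp <;> field_simp <;> linarith
    · refine ⟨y 1 / e 1, ?_⟩
      ext i
      fin_cases i <;> simp <;> field_simp <;> linarith
  · refine ⟨y 0 / e 0, ?_⟩
    ext i
    fin_cases i <;> simp <;> field_simp <;> linarith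

theorem cr_transpose (e : Fin 3 → ℝ) : (cr e)ᵀ = - cr e := by
  ext i j
  fin_cases i <;> fin_cases j <;> simp [cr]

/-- `ψ(P,Q)ᵀ = [e]× Q R` when `P R = 1`. -/
theorem psi_T {P Q : Matrix (Fin 3) (Fin 4) ℝ} {R : Matrix (Fin 4) (Fin 3) ℝ} (hR : P * R = 1) :
    (psi P Q)ᵀ = cr (Q *ᵥ cen P) * (Q * R) := by
  have h1 : Rᵀ * Pᵀ = 1 := by rw [← Matrix.transpose_mul, hR, Matrix.transpose_one]
  have h2 : psi P Q = Rᵀ * (Pᵀ * psi P Q) := by rw [← Matrix.mul_assoc, h1, Matrix.one_mul]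
  rw [h2, main_id]
  simp [Matrix.transpose_mul, cr_transpose, Matrix.mul_assoc]

theorem fund {P Q P' Q' : Matrix (Fin 3) (Fin 4) ℝ} (hP : IsCamera P) (hP' : IsCamera P')
    (hr : (psi P Q).rank = 2) {l : ℝ} (hl : l ≠ 0)
    (hpsi : psi P' Q' = l • psi P Q) :
    ∃ (H : Matrix (Fin 4) (Fin 4) ℝ) (t : ℝ), H.det ≠ 0 ∧ t ≠ 0 ∧ P' * H = t • P ∧ Q' * H = Q := by
  obtain ⟨R, hR⟩ := cam_rightInv P hP
  obtain ⟨R', hR'⟩ := cam_rightInv P' hP'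
  have hne : psi P Q ≠ 0 := ne_of_rank hr
  have he : Q *ᵥ cen P ≠ 0 := epi_ne hP hne
  have he' : Q' *ᵥ cen P' ≠ 0 := by
    apply epi_ne hP'
    rw [hpsi]
    exact smul_ne_zero hl hne
  obtain ⟨s, hs⟩ : ∃ s : ℝ, Q' *ᵥ cen P' = s • (Q *ᵥ cen P) := by
    apply psi_ker hP hr
    have := psi_epi (P := P') (Q := Q') hP'
    rw [hpsi, Matrix.smul_mulVec, smul_eq_zero] at this
    exact this.resolve_left hl
  have hs0 : s ≠ 0 := by
    rintro rfl
    simp [hs] at he'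
  have hT := psi_T (Q := Q) hR
  have hT' := psi_T (Q := Q') hR'
  rw [hpsi, Matrix.transpose_smul, hT, hs, cr_smul] at hT'
  obtain ⟨v, hv⟩ : ∃ v : Fin 3 → ℝ, s • (Q' * R') - l • (Q * R) =
      Matrix.vecMulVec (Q *ᵥ cen P) v := by
    apply cols_factor
    intro x
    apply cr_ker he
    rw [Matrix.mulVec_mulVec, Matrix.mul_sub, Matrix.mul_smul, Matrix.mul_smul, hT',
      Matrix.smul_mul, sub_self, Matrix.zero_mulVec]
  obtain ⟨d, hd⟩ : ∃ d : Fin 4 → ℝ, 1 - R * P = Matrix.vecMulVec (cen P) d := by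
    apply cols_factor
    intro x
    apply cam_ker hP
    rw [Matrix.mulVec_mulVec, Matrix.mul_sub, ← Matrix.mul_assoc, hR]
    simp
  have hdc : d ⬝ᵥ cen P = 1 := by
    have h := congrArg (· *ᵥ cen P) hd
    simp only [Matrix.sub_mulVec, ← Matrix.mulVec_mulVec, mul_cen, Matrix.mulVec_zero, sub_zero,
      Matrix.one_mulVec, Matrix.vecMulVec_mulVec] at h
    obtain ⟨i, hi⟩ := Function.ne_iff.1 (cen_ne P hP)
    have h3 := congrFun h i
    simp at h3 hi
    grind
  set c := cen P with hc
  set c' := cen P' with hc'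
  have hPc : P *ᵥ c = 0 := mul_cen P
  have hPc' : P' *ᵥ c' = 0 := mul_cen P'
  set H : Matrix (Fin 4) (Fin 4) ℝ :=
    ((s / l) • R' - (1 / (l * s)) • Matrix.vecMulVec c' v) * P + s⁻¹ • Matrix.vecMulVec c' d with hH
  have e1 : P' * H = (s / l) • P := by
    rw [hH, Matrix.mul_add, ← Matrix.mul_assoc, Matrix.mul_sub, Matrix.mul_smul, Matrix.mul_smul,
      Matrix.mul_smul, hR', Matrix.mul_vecMulVec, Matrix.mul_vecMulVec, hPc']
    simp
  have e2 : Q' * H = Q := by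
    have hQR : Q' * R' = (l / s) • (Q * R) + (1 / s) • Matrix.vecMulVec (Q *ᵥ c) v := by
      rw [← hv, smul_sub, smul_smul, smul_smul]
      rw [show 1 / s * s = 1 by field_simp, show 1 / s * l = l / s by ring]
      simp
    have hQ : Q = Q * R * P + Matrix.vecMulVec (Q *ᵥ c) d := by
      rw [← Matrix.mul_vecMulVec, ← hd, Matrix.mul_sub, Matrix.mul_one, Matrix.mul_assoc]
      simp
    rw [hH, Matrix.mul_add, ← Matrix.mul_assoc, Matrix.mul_sub, Matrix.mul_smul, Matrix.mul_smul,
      Matrix.mul_smul, hQR, Matrix.mul_vecMulVec, Matrix.mul_vecMulVec, hs,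
      Matrix.smul_vecMulVec, Matrix.smul_vecMulVec, smul_add, smul_smul, smul_smul, smul_smul,
      smul_smul]
    rw [show s / l * (l / s) = 1 by field_simp, show s / l * (1 / s) = 1 / (l * s) * s by field_simp,
      inv_mul_cancel₀ hs0, one_smul, one_smul, add_sub_cancel_right]
    exact hQ.symm
  refine ⟨H, s / l, ?_, div_ne_zero hs0 hl, e1, e2⟩
  intro hdet
  obtain ⟨x, hx0, hx⟩ := Matrix.exists_mulVec_eq_zero_iff.2 hdet
  have h1 : P *ᵥ x = 0 := by
    have : (P' * H) *ᵥ x = 0 := by rw [← Matrix.mulVec_mulVec, hx, Matrix.mulVec_zero]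
    rw [e1, Matrix.smul_mulVec, smul_eq_zero] at this
    exact this.resolve_left (div_ne_zero hs0 hl)
  obtain ⟨k, rfl⟩ := cam_ker hP h1
  have h2 : Q *ᵥ (k • cen P) = 0 := by
    rw [← e2, ← Matrix.mulVec_mulVec, hx, Matrix.mulVec_zero]
  rw [Matrix.mulVec_smul, smul_eq_zero] at h2
  rcases h2 with h2 | h2
  · simp [h2] at hx0
  · exact he h2

/-- Three collinear centres. -/
theorem collin {P0 P1 P2 : Matrix (Fin 3) (Fin 4) ℝ} (c0 : IsCamera P0) (c1 : IsCamera P1)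
    (c2 : IsCamera P2) (h01 : (psi P0 P1).rank = 2) (h02 : (psi P0 P2).rank = 2)
    {e : Fin 3 → ℝ} (he : e ≠ 0) (e1 : (psi P0 P1)ᵀ *ᵥ e = 0) (e2 : (psi P0 P2)ᵀ *ᵥ e = 0)
    (hne : P2 *ᵥ cen P1 ≠ 0) : ∃ r : ℝ, r ≠ 0 ∧ P1ᵀ * psi P1 P2 = r • (P0ᵀ * psi P0 P2) := by
  rw [psi_transpose] at e1 e2
  rw [← Matrix.rank_transpose, psi_transpose] at h01 h02
  obtain ⟨k, hk⟩ := psi_ker c1 h01 e1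
  obtain ⟨k', hk'⟩ := psi_ker c2 h02 e2
  have hk0 : k ≠ 0 := by
    rintro rfl
    simp [hk] at he
  obtain ⟨m, hm⟩ : ∃ m : ℝ, k • cen P1 - k' • cen P2 = m • cen P0 := by
    apply cam_ker c0
    rw [Matrix.mulVec_sub, Matrix.mulVec_smul, Matrix.mulVec_smul, ← hk, ← hk', sub_self]
  have h := congrArg (P2 *ᵥ ·) hm
  simp only [Matrix.mulVec_sub, Matrix.mulVec_smul, mul_cen, smul_zero, sub_zero] at h
  have h3 : P2 *ᵥ cen P1 = (m / k) • (P2 *ᵥ cen P0) := by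
    rw [div_eq_inv_mul, ← smul_smul, ← h, smul_smul, inv_mul_cancel₀ hk0, one_smul]
  refine ⟨m / k, ?_, ?_⟩
  · intro h0
    rw [h3, h0] at hne
    simp at hne
  · rw [main_id, main_id, h3, cr_smul]
    simp

theorem cam_mul {P : Matrix (Fin 3) (Fin 4) ℝ} (h : IsCamera P) {H : Matrix (Fin 4) (Fin 4) ℝ}
    (hH : H.det ≠ 0) : IsCamera (P * H) := by
  unfold IsCamera
  rw [Matrix.rank_mul_eq_left_of_isUnit_det _ _ (isUnit_iff_ne_zero.2 hH)]
  exact h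

/-- From `P' H = t P`, moving a second camera along. -/
theorem psi_move {P P' Q' : Matrix (Fin 3) (Fin 4) ℝ} {H : Matrix (Fin 4) (Fin 4) ℝ} {t : ℝ}
    (ht : t ≠ 0) (h : P' * H = t • P) : psi P (Q' * H) = (H.det / t ^ 2) • psi P' Q' := by
  have := psi_mul P' Q' H
  rw [h, psi_smul] at this
  rw [div_eq_inv_mul, ← smul_smul, ← this, smul_smul, inv_mul_cancel₀ (pow_ne_zero 2 ht), one_smul]

theorem rank_smul' {M : Matrix (Fin 3) (Fin 3) ℝ} {l : ℝ} (hl : l ≠ 0) (h : M.rank = 2) :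
    (l • M).rank = 2 := by
  have h1 : l • M = M * (l • (1 : Matrix (Fin 3) (Fin 3) ℝ)) := by simp
  rw [h1, Matrix.rank_mul_eq_left_of_isUnit_det]
  · exact h
  · simp [Matrix.det_smul, hl]

/-- Case 3.  Here `e i j` denotes the epipole `e_j^i`. -/
theorem stmt14 (F : Fin 4 → Fin 4 → Matrix (Fin 3) (Fin 3) ℝ)
    (hsym : ∀ i j, F j i = (F i j)ᵀ)
    (hrank : ∀ i j, i ≠ j → (F i j).rank = 2)
    (e : Fin 4 → Fin 4 → (Fin 3 → ℝ))
    (he : ∀ i j, i ≠ j → e i j ≠ 0 ∧ F i j *ᵥ e i j = 0)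
    (h1 : (∃ c : ℝ, e 1 0 = c • e 2 0) ∧ ¬ ∃ c : ℝ, e 1 0 = c • e 3 0)
    (h2 : (∃ c : ℝ, e 0 1 = c • e 2 1) ∧ ¬ ∃ c : ℝ, e 0 1 = c • e 3 1)
    (h3 : (∃ c : ℝ, e 0 2 = c • e 1 2) ∧ ¬ ∃ c : ℝ, e 0 2 = c • e 3 2)
    (h4 : (¬ ∃ c : ℝ, e 0 3 = c • e 1 3) ∧ (¬ ∃ c : ℝ, e 0 3 = c • e 2 3) ∧
      (¬ ∃ c : ℝ, e 1 3 = c • e 2 3) ∧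
      Module.finrank ℝ (Submodule.span ℝ {e 0 3, e 1 3, e 2 3}) = 2) :
    Compat4 F ↔
      (Compat3 (F 0 1) (F 0 2) (F 1 2) ∧ Compat3 (F 0 1) (F 0 3) (F 1 3) ∧
        Compat3 (F 0 2) (F 0 3) (F 2 3) ∧ Compat3 (F 1 2) (F 1 3) (F 2 3)) := by
  constructor
  · rintro ⟨P, lam, hP, h⟩
    have a01 := h 0 1 (by decide)
    have a02 := h 0 2 (by decide)
    have a03 := h 0 3 (by decide)
    have a12 := h 1 2 (by decide)
    have a13 := h 1 3 (by decide)
    have a23 := h 2 3 (by decide)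
    exact ⟨⟨P 0, P 1, P 2, _, _, _, hP 0, hP 1, hP 2, a01.1, a02.1, a12.1, a01.2, a02.2, a12.2⟩,
      ⟨P 0, P 1, P 3, _, _, _, hP 0, hP 1, hP 3, a01.1, a03.1, a13.1, a01.2, a03.2, a13.2⟩,
      ⟨P 0, P 2, P 3, _, _, _, hP 0, hP 2, hP 3, a02.1, a03.1, a23.1, a02.2, a03.2, a23.2⟩,
      ⟨P 1, P 2, P 3, _, _, _, hP 1, hP 2, hP 3, a12.1, a13.1, a23.1, a12.2, a13.2, a23.2⟩⟩
  rintro ⟨⟨A0, A1, A2, u01, u02, u12, cA0, cA1, cA2, nu01, nu02, nu12, A01, A02, A12⟩,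
    ⟨B0, B1, B3, v01, v03, v13, cB0, cB1, cB3, nv01, nv03, nv13, B01, B03, B13⟩,
    ⟨C0, C2, C3, w02, w03, w23, cC0, cC2, cC3, nw02, nw03, nw23, C02, C03, C23⟩, -⟩
  have r01 := hrank 0 1 (by decide)
  have r02 := hrank 0 2 (by decide)
  have r03 := hrank 0 3 (by decide)
  have r12 := hrank 1 2 (by decide)
  have r13 := hrank 1 3 (by decide)
  have r23 := hrank 2 3 (by decide)
  -- glue the triples 013 and 023 along the pair 03
  obtain ⟨H, t, hH, ht, H0, H3⟩ : ∃ (H : Matrix (Fin 4) (Fin 4) ℝ) (t : ℝ),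
      H.det ≠ 0 ∧ t ≠ 0 ∧ C0 * H = t • B0 ∧ C3 * H = B3 := by
    apply fund (l := w03 / v03) cB0 cC0
    · rw [← B03]; exact rank_smul' nv03 r03
    · exact div_ne_zero nw03 nv03
    · rw [← B03, ← C03, smul_smul, div_mul_cancel₀ _ nv03]
  -- align the triple 012 along the pair 01
  obtain ⟨K, s, hK, hs, K0, K1⟩ : ∃ (H : Matrix (Fin 4) (Fin 4) ℝ) (t : ℝ),
      H.det ≠ 0 ∧ t ≠ 0 ∧ A0 * H = t • B0 ∧ A1 * H = B1 := by
    apply fund (l := u01 / v01) cB0 cA0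
    · rw [← B01]; exact rank_smul' nv01 r01
    · exact div_ne_zero nu01 nv01
    · rw [← B01, ← A01, smul_smul, div_mul_cancel₀ _ nv01]
  have p02 : psi B0 (C2 * H) = (H.det / t ^ 2 * w02) • F 0 2 := by
    rw [psi_move ht H0, ← C02, smul_smul]
  have p23 : psi (C2 * H) B3 = (H.det * w23) • F 2 3 := by
    rw [← H3, psi_mul, ← C23, smul_smul]
  have q02 : psi B0 (A2 * K) = (K.det / s ^ 2 * u02) • F 0 2 := by
    rw [psi_move hs K0, ← A02, smul_smul]
  have q12 : psi B1 (A2 * K) = (K.det * u12) • F 1 2 := by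
    rw [← K1, psi_mul, ← A12, smul_smul]
  have np02 : H.det / t ^ 2 * w02 ≠ 0 := mul_ne_zero (div_ne_zero hH (pow_ne_zero 2 ht)) nw02
  have np23 : H.det * w23 ≠ 0 := mul_ne_zero hH nw23
  have nq02 : K.det / s ^ 2 * u02 ≠ 0 := mul_ne_zero (div_ne_zero hK (pow_ne_zero 2 hs)) nu02
  have nq12 : K.det * u12 ≠ 0 := mul_ne_zero hK nu12
  generalize H.det / t ^ 2 * w02 = x02 at p02 np02
  generalize H.det * w23 = x23 at p23 np23
  generalize K.det / s ^ 2 * u02 = y02 at q02 nq02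
  generalize K.det * u12 = y12 at q12 nq12
  have cP2 : IsCamera (C2 * H) := cam_mul cC2 hH
  have cQ2 : IsCamera (A2 * K) := cam_mul cA2 hK
  generalize C2 * H = P2 at *
  generalize A2 * K = Q2 at *
  -- the common epipole in view 0
  have he0 : e 2 0 ≠ 0 := (he 2 0 (by decide)).1
  have he02 : (F 0 2)ᵀ *ᵥ e 2 0 = 0 := by
    rw [← hsym 0 2]; exact (he 2 0 (by decide)).2
  have he01 : (F 0 1)ᵀ *ᵥ e 2 0 = 0 := by
    obtain ⟨c, hc⟩ := h1.1
    have h10 := he 1 0 (by decide)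
    rw [hsym 0 1, hc, Matrix.mulVec_smul, smul_eq_zero] at h10
    refine h10.2.resolve_left ?_
    rintro rfl
    simp at h10
  have g01 : (psi B0 B1).rank = 2 := by rw [← B01]; exact rank_smul' nv01 r01
  have g02 : (psi B0 P2).rank = 2 := by rw [p02]; exact rank_smul' np02 r02
  have g02' : (psi B0 Q2).rank = 2 := by rw [q02]; exact rank_smul' nq02 r02
  have g13 : (psi B1 B3).rank = 2 := by rw [← B13]; exact rank_smul' nv13 r13
  have g23 : (psi P2 B3).rank = 2 := by rw [p23]; exact rank_smul' np23 r23
  have z01 : (psi B0 B1)ᵀ *ᵥ e 2 0 = 0 := by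
    rw [← B01, Matrix.transpose_smul, Matrix.smul_mulVec, he01, smul_zero]
  have z02 : (psi B0 P2)ᵀ *ᵥ e 2 0 = 0 := by
    rw [p02, Matrix.transpose_smul, Matrix.smul_mulVec, he02, smul_zero]
  have z02' : (psi B0 Q2)ᵀ *ᵥ e 2 0 = 0 := by
    rw [q02, Matrix.transpose_smul, Matrix.smul_mulVec, he02, smul_zero]
  have ne1 : P2 *ᵥ cen B1 ≠ 0 := by
    intro h0
    obtain ⟨k, hk⟩ := cam_ker cP2 h0
    obtain ⟨m, hm⟩ : ∃ m : ℝ, e 1 3 = m • (B3 *ᵥ cen B1) := by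
      apply psi_ker cB1 g13
      rw [← B13, Matrix.smul_mulVec, (he 1 3 (by decide)).2, smul_zero]
    obtain ⟨n, hn⟩ : ∃ n : ℝ, e 2 3 = n • (B3 *ᵥ cen P2) := by
      apply psi_ker cP2 g23
      rw [p23, Matrix.smul_mulVec, (he 2 3 (by decide)).2, smul_zero]
    have hn0 : n ≠ 0 := by
      rintro rfl
      exact (he 2 3 (by decide)).1 (by rw [hn, zero_smul])
    apply h4.2.2.1
    refine ⟨m * k / n, ?_⟩
    rw [hm, hn, hk, Matrix.mulVec_smul, smul_smul, smul_smul, div_mul_cancel₀ _ hn0]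
  have ne2 : Q2 *ᵥ cen B1 ≠ 0 := by
    apply epi_ne cB1
    rw [q12]
    exact smul_ne_zero nq12 (ne_of_rank r12)
  obtain ⟨a, ha, ea⟩ := collin cB0 cB1 cP2 g01 g02 he0 z01 z02 ne1
  obtain ⟨b, hb, eb⟩ := collin cB0 cB1 cQ2 g01 g02' he0 z01 z02' ne2
  have p12 : psi B1 P2 = (a * x02 / (b * y02) * y12) • F 1 2 := by
    rw [← smul_smul, ← q12]
    apply transpose_cancel B1 cB1
    rw [Matrix.mul_smul, ea, eb, p02, q02, Matrix.mul_smul, Matrix.mul_smul, smul_smul, smul_smul,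
      smul_smul, mul_assoc (a * x02 / (b * y02)), div_mul_cancel₀ _ (mul_ne_zero hb nq02)]
  have np12 : a * x02 / (b * y02) * y12 ≠ 0 :=
    mul_ne_zero (div_ne_zero (mul_ne_zero ha np02) (mul_ne_zero hb nq02)) nq12
  generalize a * x02 / (b * y02) * y12 = x12 at p12 np12
  refine ⟨![B0, B1, P2, B3], !![0, v01, x02, v03; 0, 0, x12, v13; 0, 0, 0, x23; 0, 0, 0, 0],
    ?_, ?_⟩
  · intro i
    fin_cases i
    · exact cB0
    · exact cB1
    · exact cP2
    · exact cB3
  · intro i j hij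
    fin_cases i <;> fin_cases j <;> first | exact absurd hij (by decide) | skip
    · exact ⟨nv01, B01⟩
    · exact ⟨np02, p02.symm⟩
    · exact ⟨nv03, B03⟩
    · exact ⟨np12, p12.symm⟩
    · exact ⟨nv13, B13⟩
    · exact ⟨np23, p23.symm⟩
end

section
/- Let n ≥ 4 and let {F^{ij} : 1 ≤ i < j ≤ n} be a complete set of C(n,2) fundamental matrices such that for every four indices i < j < k < l the sextuple {F^{ij},F^{ik},F^{il},F^{jk},F^{jl},F^{kl}} is compatible. Then the full set {F^{ij}} is compatible. Moreover, if for each image i all the epipoles e_i^j (j ≠ i) are pairwise parallel, then the compatibility of every sub-triple {F^{ij},F^{ik},F^{jk}} already implies that {F^{ij}} is compatible, and in this case there is a solution whose camera centers are all collinear. -/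
open Matrix

/-- The sub-family of fundamental matrices indexed by pairs of indices from `s`
is compatible. -/
def CompatOn (n : ℕ) (F : Fin n → Fin n → Matrix (Fin 3) (Fin 3) ℝ)
    (s : Finset (Fin n)) : Prop :=
  ∃ (P : Fin n → Matrix (Fin 3) (Fin 4) ℝ) (lam : Fin n → Fin n → ℝ),
    (∀ i ∈ s, IsCamera (P i)) ∧
      ∀ i j, i ∈ s → j ∈ s → i < j →
        lam i j ≠ 0 ∧ lam i j • F i j = psi (P i) (P j)

theorem bm_mulVec (P P' : Matrix (Fin 3) (Fin 4) ℝ) (x y : Fin 3 → ℝ) (v : Fin 6 → ℝ) :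
    bigMat P P' x y *ᵥ v = 0 ↔
      (P *ᵥ ![v 0, v 1, v 2, v 3] + v 4 • x = 0 ∧ P' *ᵥ ![v 0, v 1, v 2, v 3] + v 5 • y = 0) := by
  simp only [funext_iff, Fin.forall_fin_succ, bigMat, mulVec, dotProduct, Fin.sum_univ_succ]
  simp [Fin.succ, mul_comm, mulVec, dotProduct, Fin.sum_univ_four, add_assoc, and_assoc]

theorem bm_add_x (P P' : Matrix (Fin 3) (Fin 4) ℝ) (y : Fin 3 → ℝ) :
    ∃ f : (Fin 3 → ℝ) →ₗ[ℝ] ℝ, ∀ x, f x = (bigMat P P' x y).det := by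
  have key : ∀ x, bigMat P P' x y
      = (bigMat P P' 0 y).updateCol 4 (fun i => if h : (i : ℕ) < 3 then x ⟨i, h⟩ else 0) := by
    intro x
    ext i j
    rw [updateCol_apply]
    fin_cases j <;> fin_cases i <;> simp [bigMat]
  refine ⟨⟨⟨fun x => (bigMat P P' x y).det, ?_⟩, ?_⟩, fun x => rfl⟩
  · intro a b
    rw [key, key a, key b, ← det_updateCol_add]
    congr 2
    ext i
    by_cases h : (i : ℕ) < 3 <;> simp [h]
  · intro c a
    simp only
    rw [key, key a, RingHom.id_apply, smul_eq_mul, ← det_updateCol_smul]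
    congr 2
    ext i
    by_cases h : (i : ℕ) < 3 <;> simp [h]

theorem bm_add_y (P P' : Matrix (Fin 3) (Fin 4) ℝ) (x : Fin 3 → ℝ) :
    ∃ f : (Fin 3 → ℝ) →ₗ[ℝ] ℝ, ∀ y, f y = (bigMat P P' x y).det := by
  have key : ∀ y, bigMat P P' x y
      = (bigMat P P' x 0).updateCol 5 (fun i => if h : (i : ℕ) < 3 then 0 else y ⟨i - 3, by omega⟩) := by
    intro x
    ext i j
    rw [updateCol_apply]
    fin_cases j <;> fin_cases i <;> simp [bigMat]
  refine ⟨⟨⟨fun y => (bigMat P P' x y).det, ?_⟩, ?_⟩, fun x => rfl⟩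
  · intro a b
    rw [key, key a, key b, ← det_updateCol_add]
    congr 2
    ext i
    by_cases h : (i : ℕ) < 3 <;> simp [h]
  · intro c a
    simp only
    rw [key, key a, RingHom.id_apply, smul_eq_mul, ← det_updateCol_smul]
    congr 2
    ext i
    by_cases h : (i : ℕ) < 3 <;> simp [h]

theorem lin_expand (f : (Fin 3 → ℝ) →ₗ[ℝ] ℝ) (x : Fin 3 → ℝ) :
    f x = ∑ a, x a * f (Pi.single a 1) := by
  rw [LinearMap.pi_apply_eq_sum_univ f x]
  refine Finset.sum_congr rfl fun a _ => ?_
  rw [smul_eq_mul]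
  congr 2
  ext j
  simp [Pi.single_apply, eq_comm]

theorem psi_apply (P P' : Matrix (Fin 3) (Fin 4) ℝ) (x y : Fin 3 → ℝ) :
    x ⬝ᵥ (psi P P' *ᵥ y) = (bigMat P P' x y).det := by
  obtain ⟨f, hf⟩ := bm_add_x P P' y
  rw [← hf, lin_expand]
  simp only [dotProduct, mulVec]
  refine Finset.sum_congr rfl fun a _ => ?_
  congr 1
  obtain ⟨g, hg⟩ := bm_add_y P P' (Pi.single a 1)
  rw [hf, ← hg, lin_expand]
  refine Finset.sum_congr rfl fun b _ => ?_
  rw [hg, mul_comm]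
  rfl

def CRel (P P' : Matrix (Fin 3) (Fin 4) ℝ) (F : Matrix (Fin 3) (Fin 3) ℝ) : Prop :=
  ∀ X, (P *ᵥ X) ⬝ᵥ (F *ᵥ (P' *ᵥ X)) = 0

def NoKer (P P' : Matrix (Fin 3) (Fin 4) ℝ) : Prop :=
  ∀ X, P *ᵥ X = 0 → P' *ᵥ X = 0 → X = 0

def Good (P P' : Matrix (Fin 3) (Fin 4) ℝ) (F : Matrix (Fin 3) (Fin 3) ℝ) : Prop :=
  NoKer P P' ∧ CRel P P' F

def Surj (P : Matrix (Fin 3) (Fin 4) ℝ) : Prop := ∀ v, ∃ X, P *ᵥ X = v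

theorem vec4 (X : Fin 4 → ℝ) : ![X 0, X 1, X 2, X 3] = X := by
  ext i; fin_cases i <;> rfl

theorem rel_psi (P P' : Matrix (Fin 3) (Fin 4) ℝ) : CRel P P' (psi P P') := by
  intro X
  rw [psi_apply, ← exists_mulVec_eq_zero_iff]
  refine ⟨![X 0, X 1, X 2, X 3, -1, -1], ?_, ?_⟩
  · intro h
    have := congrFun h 4
    simp at this
  · rw [bm_mulVec]
    have := vec4 X
    simp [this]

theorem nk_of_psi (P P' : Matrix (Fin 3) (Fin 4) ℝ) (h : psi P P' ≠ 0) : NoKer P P' := by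
  intro X h1 h2
  by_contra hX
  apply h
  ext a b
  change (bigMat P P' (Pi.single a 1) (Pi.single b 1)).det = 0
  rw [← exists_mulVec_eq_zero_iff]
  refine ⟨![X 0, X 1, X 2, X 3, 0, 0], ?_, ?_⟩
  · intro h
    apply hX
    ext i
    fin_cases i
    · exact congrFun h 0
    · exact congrFun h 1
    · exact congrFun h 2
    · exact congrFun h 3
  · rw [bm_mulVec]
    have := vec4 X
    simp [this, h1, h2]

theorem good_of_psi {P P' : Matrix (Fin 3) (Fin 4) ℝ} {F : Matrix (Fin 3) (Fin 3) ℝ} {l : ℝ}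
    (hF : F ≠ 0) (hl : l ≠ 0) (h : l • F = psi P P') : Good P P' F := by
  refine ⟨nk_of_psi _ _ (h ▸ smul_ne_zero hl hF), fun X => ?_⟩
  have := rel_psi P P' X
  rw [← h, smul_mulVec, dotProduct_smul, smul_eq_mul] at this
  exact (mul_eq_zero.1 this).resolve_left hl

theorem CRel.polar {P P' : Matrix (Fin 3) (Fin 4) ℝ} {F : Matrix (Fin 3) (Fin 3) ℝ}
    (h : CRel P P' F) (X Y : Fin 4 → ℝ) :
    (P *ᵥ X) ⬝ᵥ (F *ᵥ (P' *ᵥ Y)) + (P *ᵥ Y) ⬝ᵥ (F *ᵥ (P' *ᵥ X)) = 0 := by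
  have h1 := h (X + Y)
  have h2 := h X
  have h3 := h Y
  simp only [mulVec_add, add_dotProduct, dotProduct_add] at h1
  linarith

theorem Good.symm {P P' : Matrix (Fin 3) (Fin 4) ℝ} {F : Matrix (Fin 3) (Fin 3) ℝ}
    (h : Good P P' F) : Good P' P Fᵀ := by
  refine ⟨fun X a b => h.1 X b a, fun X => ?_⟩
  rw [mulVec_transpose, dotProduct_comm, ← dotProduct_mulVec]
  exact h.2 X

/-- left change of coordinates -/
theorem Good.left {P P' : Matrix (Fin 3) (Fin 4) ℝ} {F B B' : Matrix (Fin 3) (Fin 3) ℝ}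
    (h : Good (B * P) (B' * P') F) : Good P P' (Bᵀ * F * B') := by
  refine ⟨fun X a b => h.1 X (by rw [← mulVec_mulVec, a, mulVec_zero])
    (by rw [← mulVec_mulVec, b, mulVec_zero]), fun X => ?_⟩
  have := h.2 X
  rw [← mulVec_mulVec, ← mulVec_mulVec] at this
  rw [← mulVec_mulVec, ← mulVec_mulVec, mulVec_transpose, dotProduct_comm, ← dotProduct_mulVec,
    dotProduct_comm]
  exact this

theorem CRel.left {P P' : Matrix (Fin 3) (Fin 4) ℝ} {F B B' : Matrix (Fin 3) (Fin 3) ℝ}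
    (h : CRel (B * P) (B' * P') F) : CRel P P' (Bᵀ * F * B') := by
  intro X
  have := h X
  rw [← mulVec_mulVec, ← mulVec_mulVec] at this
  rw [← mulVec_mulVec, ← mulVec_mulVec, mulVec_transpose, dotProduct_comm, ← dotProduct_mulVec,
    dotProduct_comm]
  exact this

theorem Good.right {P P' : Matrix (Fin 3) (Fin 4) ℝ} {F : Matrix (Fin 3) (Fin 3) ℝ}
    (h : Good P P' F) (Q : Matrix (Fin 4) (Fin 4) ℝ) (hQ : Q.det ≠ 0) (s t : ℝ) (hs : s ≠ 0)
    (ht : t ≠ 0) : Good (s • (P * Q)) (t • (P' * Q)) F := by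
  refine ⟨fun X a b => ?_, fun X => ?_⟩
  · rw [smul_mulVec, smul_eq_zero, ← mulVec_mulVec] at a b
    have := h.1 _ (a.resolve_left hs) (b.resolve_left ht)
    by_contra hX
    exact hQ (exists_mulVec_eq_zero_iff.1 ⟨X, hX, this⟩)
  · have := h.2 (Q *ᵥ X)
    rw [smul_mulVec, smul_mulVec, ← mulVec_mulVec, ← mulVec_mulVec, mulVec_smul, smul_dotProduct,
      dotProduct_smul, this]
    simp

theorem isCamera_iff (P : Matrix (Fin 3) (Fin 4) ℝ) : IsCamera P ↔ Surj P := by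
  unfold IsCamera Surj
  rw [Matrix.rank]
  constructor
  · intro h v
    have : P.mulVecLin.range = ⊤ := Submodule.eq_top_of_finrank_eq (by simpa using h)
    obtain ⟨X, hX⟩ := LinearMap.range_eq_top.1 this v
    exact ⟨X, hX⟩
  · intro h
    have : P.mulVecLin.range = ⊤ := LinearMap.range_eq_top.2 h
    rw [this]
    simp

theorem ker1 {m k : ℕ} (A : Matrix (Fin m) (Fin (k+1)) ℝ) (h : A.rank = k) (b X : Fin (k+1) → ℝ)
    (hb : b ≠ 0) (hAb : A *ᵥ b = 0) (hX : A *ᵥ X = 0) : ∃ c : ℝ, X = c • b := by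
  have h1 := A.mulVecLin.finrank_range_add_finrank_ker
  rw [Matrix.rank] at h
  rw [h] at h1
  simp at h1
  have := (finrank_eq_one_iff_of_nonzero' (⟨b, hAb⟩ : A.mulVecLin.ker)
    (by simpa [Subtype.ext_iff] using hb)).1 (by omega) ⟨X, hX⟩
  obtain ⟨c, hc⟩ := this
  exact ⟨c, by simpa [Subtype.ext_iff] using hc.symm⟩

theorem exists_ker {P : Matrix (Fin 3) (Fin 4) ℝ} (h : IsCamera P) : ∃ c, c ≠ 0 ∧ P *ᵥ c = 0 := by
  have h1 := P.mulVecLin.finrank_range_add_finrank_ker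
  unfold IsCamera at h
  rw [Matrix.rank] at h
  rw [h] at h1
  simp at h1
  have : P.mulVecLin.ker ≠ ⊥ := by
    intro h; rw [h] at h1; simp at h1
  obtain ⟨c, hc, h0⟩ := Submodule.exists_mem_ne_zero_of_ne_bot this
  exact ⟨c, h0, hc⟩

def J3 : Matrix (Fin 3) (Fin 3) ℝ := !![0,1,0;-1,0,0;0,0,0]

theorem compl3 (v : Fin 3 → ℝ) (hv : v ≠ 0) :
    ∃ B : Matrix (Fin 3) (Fin 3) ℝ, B.det ≠ 0 ∧ B *ᵥ ![0,0,1] = v := by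
  by_cases h2 : v 2 = 0
  · by_cases h1 : v 1 = 0
    · by_cases h0 : v 0 = 0
      · exact absurd (by ext i; fin_cases i <;> simp [h0,h1,h2]) hv
      · refine ⟨!![0,0,v 0;1,0,v 1;0,1,v 2], by simp [det_fin_three, h0], ?_⟩
        ext i; fin_cases i <;> simp [mulVec, dotProduct, Fin.sum_univ_succ]
    · refine ⟨!![1,0,v 0;0,0,v 1;0,1,v 2], by simp [det_fin_three, h1], ?_⟩
      ext i; fin_cases i <;> simp [mulVec, dotProduct, Fin.sum_univ_succ]
  · refine ⟨!![1,0,v 0;0,1,v 1;0,0,v 2], by simp [det_fin_three, h2], ?_⟩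
    ext i; fin_cases i <;> simp [mulVec, dotProduct, Fin.sum_univ_succ]

theorem nfr (M : Matrix (Fin 3) (Fin 3) ℝ) (hM : M.rank = 2) (h3 : ∀ j, M 2 j = 0) :
    ∃ B : Matrix (Fin 3) (Fin 3) ℝ, B.det ≠ 0 ∧ M * B = J3 := by
  have hdet : M.det = 0 := det_eq_zero_of_row_eq_zero 2 h3
  obtain ⟨b, hb, hMb⟩ := exists_mulVec_eq_zero_iff.2 hdet
  let N : Matrix (Fin 3) (Fin 3) ℝ := M.updateRow 2 b
  have hN : N.det ≠ 0 := by
    intro h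
    obtain ⟨X, hX, hNX⟩ := exists_mulVec_eq_zero_iff.2 h
    have h0 := congrFun hNX 0
    have h1 := congrFun hNX 1
    have h2 := congrFun hNX 2
    have hMX : M *ᵥ X = 0 := by
      ext i
      fin_cases i
      · simpa [N, mulVec] using h0
      · simpa [N, mulVec] using h1
      · simp [mulVec, dotProduct, h3]
    obtain ⟨c, rfl⟩ := ker1 M hM b X hb hMb hMX
    simp only [N, mulVec, updateRow_self, dotProduct_smul, Pi.zero_apply, smul_eq_mul] at h2
    rcases mul_eq_zero.1 h2 with h | h
    · simp [h] at hX
    · exact hb (dotProduct_self_eq_zero.1 h)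
  have hNN : N * N⁻¹ = 1 := mul_nonsing_inv _ (isUnit_iff_ne_zero.2 hN)
  have hMN : M = !![1,0,0;0,1,0;0,0,0] * N := by
    ext i j
    fin_cases i <;> simp [Matrix.mul_apply, Fin.sum_univ_succ, N, h3, updateRow_apply]
  refine ⟨N⁻¹ * !![0,1,0;-1,0,0;0,0,1], ?_, ?_⟩
  · rw [det_mul]
    refine mul_ne_zero ?_ (by simp [det_fin_three])
    intro h
    have := congrArg det hNN
    rw [det_mul, h] at this
    simp at this
  · rw [hMN, Matrix.mul_assoc, ← Matrix.mul_assoc N, hNN, Matrix.one_mul]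
    ext i j
    fin_cases i <;> fin_cases j <;> simp [J3, Matrix.mul_apply, Fin.sum_univ_succ]

theorem nf1 (F B : Matrix (Fin 3) (Fin 3) ℝ) (hF : F.rank = 2) (hB : B.det ≠ 0)
    (h : Fᵀ *ᵥ (B *ᵥ ![0,0,1]) = 0) :
    ∃ B' : Matrix (Fin 3) (Fin 3) ℝ, B'.det ≠ 0 ∧ Bᵀ * F * B' = J3 := by
  apply nfr
  · rw [rank_mul_eq_right_of_isUnit_det _ _ (by rw [det_transpose]; exact isUnit_iff_ne_zero.2 hB), hF]
  · intro j
    have := congrFun h j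
    rw [mulVec_mulVec, ← transpose_transpose B, ← transpose_mul] at this
    simpa [mulVec, dotProduct, Fin.sum_univ_succ] using this

theorem nf (F : Matrix (Fin 3) (Fin 3) ℝ) (hF : F.rank = 2) :
    ∃ B B' : Matrix (Fin 3) (Fin 3) ℝ, B.det ≠ 0 ∧ B'.det ≠ 0 ∧ Bᵀ * F * B' = J3 := by
  have hd : Fᵀ.det = 0 := by
    rw [det_transpose]
    by_contra h
    have := rank_of_isUnit F ((isUnit_iff_isUnit_det _).2 (isUnit_iff_ne_zero.2 h))
    rw [hF] at this
    simp at this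
  obtain ⟨b, hb, h⟩ := exists_mulVec_eq_zero_iff.2 hd
  obtain ⟨B, hB, hb'⟩ := compl3 b hb
  obtain ⟨B', h1, h2⟩ := nf1 F B hF hB (by rw [hb', h])
  exact ⟨B, B', hB, h1, h2⟩

theorem surj_left {P : Matrix (Fin 3) (Fin 4) ℝ} {B : Matrix (Fin 3) (Fin 3) ℝ}
    (h : Surj (B * P)) (hB : B.det ≠ 0) : Surj P := by
  intro v
  obtain ⟨X, hX⟩ := h (B *ᵥ v)
  refine ⟨X, ?_⟩
  rw [← mulVec_mulVec] at hX
  by_contra hne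
  exact hB (exists_mulVec_eq_zero_iff.1 ⟨P *ᵥ X - v, sub_ne_zero.2 hne, by
    rw [mulVec_sub, hX, sub_self]⟩)

theorem surj_left' {P : Matrix (Fin 3) (Fin 4) ℝ} {B : Matrix (Fin 3) (Fin 3) ℝ}
    (h : Surj P) (hB : B.det ≠ 0) : Surj (B * P) := by
  intro v
  obtain ⟨X, hX⟩ := h (B⁻¹ *ᵥ v)
  refine ⟨X, ?_⟩
  rw [← mulVec_mulVec, hX, mulVec_mulVec, mul_nonsing_inv _ (isUnit_iff_ne_zero.2 hB), one_mulVec]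

theorem factor (P : Matrix (Fin 3) (Fin 4) ℝ) {B : Matrix (Fin 3) (Fin 3) ℝ} (hB : B.det ≠ 0) :
    ∃ P' : Matrix (Fin 3) (Fin 4) ℝ, P = B * P' :=
  ⟨B⁻¹ * P, by rw [← Matrix.mul_assoc, mul_nonsing_inv _ (isUnit_iff_ne_zero.2 hB), Matrix.one_mul]⟩

theorem relJ {P P' : Matrix (Fin 3) (Fin 4) ℝ} (h : CRel P P' J3) (hP : Surj P) (hP' : Surj P') :
    ∃ l : ℝ, l ≠ 0 ∧ ∀ X, (P' *ᵥ X) 0 = l * (P *ᵥ X) 0 ∧ (P' *ᵥ X) 1 = l * (P *ᵥ X) 1 := by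
  have hp := h.polar
  have e : ∀ a b : Fin 3 → ℝ, a ⬝ᵥ (J3 *ᵥ b) = a 0 * b 1 - a 1 * b 0 := by
    intro a b
    simp [J3, mulVec, dotProduct, Fin.sum_univ_succ]
    ring
  simp only [e] at hp
  obtain ⟨X1, h1⟩ := hP ![1,0,0]
  obtain ⟨X2, h2⟩ := hP ![0,1,0]
  have a0 : ∀ X, (P' *ᵥ X) 1 = (P' *ᵥ X1) 0 * (P *ᵥ X) 1 := by
    intro X
    have q := hp X1 X
    have q1 := hp X1 X1
    simp [h1] at q q1
    have : (P' *ᵥ X1) 1 = 0 := by linarith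
    rw [this] at q
    linarith
  have a1 : ∀ X, (P' *ᵥ X) 0 = (P' *ᵥ X2) 1 * (P *ᵥ X) 0 := by
    intro X
    have q := hp X2 X
    have q1 := hp X2 X2
    simp [h2] at q q1
    have : (P' *ᵥ X2) 0 = 0 := by linarith
    rw [this] at q
    linarith
  have hl : (P' *ᵥ X2) 1 = (P' *ᵥ X1) 0 := by
    rw [a0 X2]; simp [h2]
  refine ⟨(P' *ᵥ X1) 0, ?_, fun X => ⟨by rw [a1, hl], a0 X⟩⟩
  intro h0
  obtain ⟨Y, hY⟩ := hP' ![1,0,0]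
  have := a1 Y
  rw [hl, h0, hY] at this
  simp at this

theorem J_apply (a b : Fin 3 → ℝ) : a ⬝ᵥ (J3 *ᵥ b) = a 0 * b 1 - a 1 * b 0 := by
  simp [J3, mulVec, dotProduct, Fin.sum_univ_succ]
  ring

theorem rows_of {P P' : Matrix (Fin 3) (Fin 4) ℝ} {l : ℝ}
    (h : ∀ X, (P' *ᵥ X) 0 = l * (P *ᵥ X) 0 ∧ (P' *ᵥ X) 1 = l * (P *ᵥ X) 1) :
    ∀ j, P' 0 j = l * P 0 j ∧ P' 1 j = l * P 1 j := by
  intro j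
  simpa using h (Pi.single j 1)

theorem mdet {P P' : Matrix (Fin 3) (Fin 4) ℝ} {l m : ℝ} (hm : m ≠ 0) (hk : NoKer P P')
    (h : ∀ X, (P' *ᵥ X) 0 = l * (P *ᵥ X) 0 ∧ (P' *ᵥ X) 1 = l * (P *ᵥ X) 1) :
    (Matrix.of ![P 0, P 1, P 2, m • P' 2]).det ≠ 0 := by
  intro h0
  obtain ⟨X, hX, hMX⟩ := exists_mulVec_eq_zero_iff.2 h0
  have h0 : (P *ᵥ X) 0 = 0 := by simpa [mulVec] using congrFun hMX 0
  have h1 : (P *ᵥ X) 1 = 0 := by simpa [mulVec] using congrFun hMX 1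
  have h2 : (P *ᵥ X) 2 = 0 := by simpa [mulVec] using congrFun hMX 2
  have h3 : (P' *ᵥ X) 2 = 0 := by
    have h4 : (m • P' 2) ⬝ᵥ X = 0 := congrFun hMX 3
    rw [smul_dotProduct, smul_eq_mul] at h4
    exact (mul_eq_zero.1 h4).resolve_left hm
  apply hX
  apply hk X
  · ext i; fin_cases i <;> assumption
  · ext i; fin_cases i
    · simp [(h X).1, h0]
    · simp [(h X).2, h1]
    · exact h3

theorem rigidJ {P1 P2 P1' P2' : Matrix (Fin 3) (Fin 4) ℝ}
    (s1 : Surj P1) (s2 : Surj P2) (s1' : Surj P1') (s2' : Surj P2')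
    (g : Good P1 P2 J3) (g' : Good P1' P2' J3) :
    ∃ (Q : Matrix (Fin 4) (Fin 4) ℝ) (s t : ℝ), Q.det ≠ 0 ∧ s ≠ 0 ∧ t ≠ 0 ∧
      P1' = s • (P1 * Q) ∧ P2' = t • (P2 * Q) := by
  obtain ⟨l, hl, h⟩ := relJ g.2 s1 s2
  obtain ⟨l', hl', h'⟩ := relJ g'.2 s1' s2'
  have d := mdet one_ne_zero g.1 h
  have d' := mdet (div_ne_zero hl hl') g'.1 h'
  have r := rows_of h
  have r' := rows_of h'
  rw [one_smul] at d
  set M := Matrix.of ![P1 0, P1 1, P1 2, P2 2] with hM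
  set M' := Matrix.of ![P1' 0, P1' 1, P1' 2, (l / l') • P2' 2] with hM'
  have hMM : M * M⁻¹ = 1 := mul_nonsing_inv _ (isUnit_iff_ne_zero.2 d)
  have hQ : M * (M⁻¹ * M') = M' := by rw [← Matrix.mul_assoc, hMM, Matrix.one_mul]
  generalize hQQ : M⁻¹ * M' = Q at hQ
  have hdQ : Q.det ≠ 0 := by
    intro h
    apply d'
    rw [← hQ, det_mul, h, mul_zero]
  have k0 : ∀ j, (P1 * Q) 0 j = P1' 0 j := fun j => congrFun (congrFun hQ 0) j
  have k1 : ∀ j, (P1 * Q) 1 j = P1' 1 j := fun j => congrFun (congrFun hQ 1) j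
  have k2 : ∀ j, (P1 * Q) 2 j = P1' 2 j := fun j => congrFun (congrFun hQ 2) j
  have k3 : ∀ j, (P2 * Q) 2 j = (l / l') * P2' 2 j := fun j => congrFun (congrFun hQ 3) j
  have k4 : ∀ j, (P2 * Q) 0 j = l * P1' 0 j := by
    intro j
    rw [← k0]
    simp [Matrix.mul_apply, Finset.mul_sum, (r _).1, mul_assoc]
  have k5 : ∀ j, (P2 * Q) 1 j = l * P1' 1 j := by
    intro j
    rw [← k1]
    simp [Matrix.mul_apply, Finset.mul_sum, (r _).2, mul_assoc]
  refine ⟨Q, 1, l' / l, hdQ, one_ne_zero, div_ne_zero hl' hl, ?_, ?_⟩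
  · ext i j
    fin_cases i
    · simp [k0]
    · simp [k1]
    · simp [k2]
  · ext i j
    fin_cases i
    · simp [k4, (r' j).1]; field_simp
    · simp [k5, (r' j).2]; field_simp
    · simp [k3]; field_simp

theorem rigid {P1 P2 P1' P2' : Matrix (Fin 3) (Fin 4) ℝ} {F : Matrix (Fin 3) (Fin 3) ℝ}
    (hF : F.rank = 2)
    (s1 : Surj P1) (s2 : Surj P2) (s1' : Surj P1') (s2' : Surj P2')
    (g : Good P1 P2 F) (g' : Good P1' P2' F) :
    ∃ (Q : Matrix (Fin 4) (Fin 4) ℝ) (s t : ℝ), Q.det ≠ 0 ∧ s ≠ 0 ∧ t ≠ 0 ∧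
      P1' = s • (P1 * Q) ∧ P2' = t • (P2 * Q) := by
  obtain ⟨B, B', hB, hB', hJ⟩ := nf F hF
  obtain ⟨P1, rfl⟩ := factor P1 hB
  obtain ⟨P1', rfl⟩ := factor P1' hB
  obtain ⟨P2, rfl⟩ := factor P2 hB'
  obtain ⟨P2', rfl⟩ := factor P2' hB'
  have g := g.left
  have g' := g'.left
  rw [hJ] at g g'
  obtain ⟨Q, s, t, h1, h2, h3, h4, h5⟩ := rigidJ (surj_left s1 hB) (surj_left s2 hB')
    (surj_left s1' hB) (surj_left s2' hB') g g'
  refine ⟨Q, s, t, h1, h2, h3, ?_, ?_⟩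
  · rw [h4, Matrix.mul_smul, Matrix.mul_assoc]
  · rw [h5, Matrix.mul_smul, Matrix.mul_assoc]

theorem to_psi {P P' : Matrix (Fin 3) (Fin 4) ℝ} {F : Matrix (Fin 3) (Fin 3) ℝ}
    (hF : F.rank = 2) (s1 : Surj P) (s2 : Surj P') (g : Good P P' F) :
    ∃ l : ℝ, l ≠ 0 ∧ l • F = psi P P' := by
  obtain ⟨B, B', hB, hB', hJ⟩ := nf F hF
  obtain ⟨P, rfl⟩ := factor P hB
  obtain ⟨P', rfl⟩ := factor P' hB'
  have k := (rel_psi (B * P) (B' * P')).left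
  have gg := g.left
  have s1 := surj_left s1 hB
  have s2 := surj_left s2 hB'
  rw [hJ] at gg
  obtain ⟨l, hl, h⟩ := relJ gg.2 s1 s2
  have hne : psi (B * P) (B' * P') ≠ 0 := by
    intro h0
    have := psi_apply (B * P) (B' * P') (B *ᵥ ![1,0,0]) (B' *ᵥ ![0,1,0])
    rw [h0] at this
    simp only [zero_mulVec, dotProduct_zero] at this
    obtain ⟨v, hv, hv0⟩ := exists_mulVec_eq_zero_iff.2 this.symm
    rw [bm_mulVec] at hv0
    obtain ⟨h1, h2⟩ := hv0
    rw [← mulVec_mulVec, ← mulVec_smul, ← mulVec_add] at h1 h2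
    have h1 : P *ᵥ ![v 0, v 1, v 2, v 3] + v 4 • ![1,0,0] = 0 := by
      by_contra hne
      exact hB (exists_mulVec_eq_zero_iff.1 ⟨_, hne, h1⟩)
    have h2 : P' *ᵥ ![v 0, v 1, v 2, v 3] + v 5 • ![0,1,0] = 0 := by
      by_contra hne
      exact hB' (exists_mulVec_eq_zero_iff.1 ⟨_, hne, h2⟩)
    have hX := h ![v 0, v 1, v 2, v 3]
    have a0 := congrFun h1 0
    have a1 := congrFun h1 1
    have a2 := congrFun h1 2
    have b0 := congrFun h2 0
    have b1 := congrFun h2 1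
    have b2 := congrFun h2 2
    rw [Pi.add_apply] at a0 a1 a2 b0 b1 b2
    rw [hX.1] at b0
    rw [hX.2] at b1
    simp [hl] at a0 a1 a2 b0 b1 b2
    rw [b0] at a0
    rw [a1] at b1
    have hz := gg.1 ![v 0, v 1, v 2, v 3] (by ext i; fin_cases i <;> assumption) (by
      ext i; fin_cases i
      · simp [hX.1, b0]
      · simp [hX.2, a1]
      · exact b2)
    apply hv
    ext i
    fin_cases i
    · exact congrFun hz 0
    · exact congrFun hz 1
    · exact congrFun hz 2
    · exact congrFun hz 3
    · simpa using a0
    · simpa using b1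
  have hex : ∃ m : ℝ, Bᵀ * psi (B * P) (B' * P') * B' = m • J3 := by
    generalize Bᵀ * psi (B * P) (B' * P') * B' = G at k
    have d := mdet one_ne_zero gg.1 h
    have key : ∀ a b c d : ℝ, (![a, b, c] : Fin 3 → ℝ) ⬝ᵥ (G *ᵥ ![l * a, l * b, d]) = 0 := by
      intro a b c w
      have hinv := mul_nonsing_inv _ (isUnit_iff_ne_zero.2 d)
      set M := Matrix.of ![P 0, P 1, P 2, (1:ℝ) • P' 2] with hM
      have hX : M *ᵥ (M⁻¹ *ᵥ ![a, b, c, w]) = ![a, b, c, w] := by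
        rw [mulVec_mulVec, hinv, one_mulVec]
      generalize M⁻¹ *ᵥ ![a, b, c, w] = X at hX
      have h0 : (P *ᵥ X) 0 = a := by simpa [hM, mulVec] using congrFun hX 0
      have h1 : (P *ᵥ X) 1 = b := by simpa [hM, mulVec] using congrFun hX 1
      have h2 : (P *ᵥ X) 2 = c := by simpa [hM, mulVec] using congrFun hX 2
      have h3 : (P' *ᵥ X) 2 = w := by simpa [hM, mulVec] using congrFun hX 3
      have e1 : P *ᵥ X = ![a, b, c] := by
        ext i; fin_cases i <;> assumption
      have e2 : P' *ᵥ X = ![l * a, l * b, w] := by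
        ext i; fin_cases i
        · simp [(h X).1, h0]
        · simp [(h X).2, h1]
        · exact h3
      have := k X
      rwa [e1, e2] at this
    simp only [mulVec, dotProduct, Fin.sum_univ_three] at key
    simp at key
    have q1 := key 1 0 0 0
    have q2 := key 0 1 0 0
    have q3 := key 0 0 1 1
    have q4 := key 1 0 1 0
    have q5 := key 0 1 1 0
    have q6 := key 1 0 0 1
    have q7 := key 0 1 0 1
    have q8 := key 1 1 0 0
    simp [hl] at q1 q2 q3 q4 q5 q6 q7 q8
    simp [q1, q2, q3, hl] at q4 q5 q6 q7 q8
    refine ⟨G 0 1, ?_⟩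
    have q9 : G 1 0 = - G 0 1 := by
      apply mul_right_cancel₀ hl
      linarith
    ext i j
    fin_cases i <;> fin_cases j <;> simp [J3, q1, q2, q3, q4, q5, q6, q7, q9]
  obtain ⟨m, hm⟩ := hex
  rw [← hJ] at hm
  have hmF : m • F = psi (B * P) (B' * P') := by
    have i1 : Bᵀ⁻¹ * Bᵀ = 1 := nonsing_inv_mul _ (by rw [det_transpose]; exact isUnit_iff_ne_zero.2 hB)
    have i2 : B' * B'⁻¹ = 1 := mul_nonsing_inv _ (isUnit_iff_ne_zero.2 hB')
    have cancel : ∀ A : Matrix (Fin 3) (Fin 3) ℝ, Bᵀ⁻¹ * (Bᵀ * A * B') * B'⁻¹ = A := by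
      intro A
      rw [Matrix.mul_assoc, Matrix.mul_assoc (Bᵀ * A), i2, Matrix.mul_one, ← Matrix.mul_assoc, i1,
        Matrix.one_mul]
    rw [← cancel (psi _ _), hm, Matrix.mul_smul, Matrix.smul_mul, cancel]
  refine ⟨m, ?_, hmF⟩
  rintro rfl
  exact hne (by rw [← hmF, zero_smul])

def Ind (a b c : Fin 4 → ℝ) : Prop :=
  ∀ x y z : ℝ, x • a + y • b + z • c = 0 → x = 0 ∧ y = 0 ∧ z = 0

/-- the third camera is determined by two others -/
theorem third {P1 P2 P3 P3' : Matrix (Fin 3) (Fin 4) ℝ} {F G : Matrix (Fin 3) (Fin 3) ℝ}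
    (hF : F.rank = 2) (hG : G.rank = 2) (s1 : IsCamera P1) (s2 : IsCamera P2) (s3 : IsCamera P3)
    (s3' : IsCamera P3') {c1 c2 c3 : Fin 4 → ℝ} (h1 : P1 *ᵥ c1 = 0) (h2 : P2 *ᵥ c2 = 0)
    (h3 : P3 *ᵥ c3 = 0) (hi : Ind c1 c2 c3)
    (a : Good P1 P3 F) (a' : Good P1 P3' F) (b : Good P2 P3 G) (b' : Good P2 P3' G) :
    ∃ r : ℝ, r ≠ 0 ∧ P3' = r • P3 := by
  have n1 : c1 ≠ 0 := by
    rintro rfl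
    simpa using (hi 1 0 0 (by simp)).1
  have n2 : c2 ≠ 0 := by
    rintro rfl
    simpa using (hi 0 1 0 (by simp)).2.1
  have n3 : c3 ≠ 0 := by
    rintro rfl
    simpa using (hi 0 0 1 (by simp)).2.2
  have aux : ∀ (P : Matrix (Fin 3) (Fin 4) ℝ) (c : Fin 4 → ℝ) (H : Matrix (Fin 3) (Fin 3) ℝ),
      H.rank = 2 → IsCamera P → c ≠ 0 → P *ᵥ c = 0 → Good P P3 H → Good P P3' H →
      ∃ r : ℝ, r ≠ 0 ∧ ∀ X, ∃ u : ℝ, P3' *ᵥ X = r • (P3 *ᵥ X) + u • (P3 *ᵥ c) := by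
    intro P c H hH sP hc hPc g g'
    obtain ⟨Q, s, t, hQ, hs, ht, e1, e2⟩ := rigid hH ((isCamera_iff _).1 sP) ((isCamera_iff _).1 s3)
      ((isCamera_iff _).1 sP) ((isCamera_iff _).1 s3') g g'
    refine ⟨t * s⁻¹, mul_ne_zero ht (inv_ne_zero hs), fun X => ?_⟩
    have : P *ᵥ (Q *ᵥ X - s⁻¹ • X) = 0 := by
      have e3 : P *ᵥ X = s • (P *ᵥ (Q *ᵥ X)) := by
        conv_lhs => rw [e1]
        rw [smul_mulVec, mulVec_mulVec]
      rw [mulVec_sub, mulVec_smul, e3, smul_smul, inv_mul_cancel₀ hs, one_smul, sub_self]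
    obtain ⟨u, hu⟩ := ker1 P sP c _ hc hPc this
    refine ⟨t * u, ?_⟩
    have hu' : Q *ᵥ X = s⁻¹ • X + u • c := by rw [← hu]; abel
    rw [e2, smul_mulVec, ← mulVec_mulVec, hu', mulVec_add, smul_add, mulVec_smul, mulVec_smul,
      smul_smul, smul_smul]
  obtain ⟨r, hr, hu⟩ := aux P1 c1 F hF s1 n1 h1 a a'
  obtain ⟨q, hq, hv⟩ := aux P2 c2 G hG s2 n2 h2 b b'
  have hind : ∀ x y : ℝ, x • (P3 *ᵥ c1) + y • (P3 *ᵥ c2) = 0 → x = 0 ∧ y = 0 := by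
    intro x y hxy
    rw [← mulVec_smul, ← mulVec_smul, ← mulVec_add] at hxy
    obtain ⟨z, hz⟩ := ker1 P3 s3 c3 _ n3 h3 hxy
    have := hi x y (-z) (by rw [hz, neg_smul, add_neg_cancel])
    exact ⟨this.1, this.2.1⟩
  have hrq : r = q := by
    by_contra hne
    have hne' : r - q ≠ 0 := sub_ne_zero.2 hne
    -- every image vector would be a combination of two vectors
    have hall : ∀ w : Fin 3 → ℝ, w ∈ Submodule.span ℝ ({P3 *ᵥ c1, P3 *ᵥ c2} : Set (Fin 3 → ℝ)) := by
      intro w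
      obtain ⟨X, rfl⟩ := (isCamera_iff _).1 s3 w
      obtain ⟨u, hu⟩ := hu X
      obtain ⟨v, hv⟩ := hv X
      rw [Submodule.mem_span_pair]
      refine ⟨-(r - q)⁻¹ * u, (r - q)⁻¹ * v, ?_⟩
      have h4 : (r - q) • (P3 *ᵥ X) = -u • (P3 *ᵥ c1) + v • (P3 *ᵥ c2) := by
        rw [hu] at hv
        rw [sub_smul, neg_smul, sub_eq_iff_eq_add]
        rw [← sub_eq_zero] at hv ⊢
        rw [← hv]
        abel
      have h5 : P3 *ᵥ X = (r - q)⁻¹ • ((r - q) • (P3 *ᵥ X)) := by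
        rw [smul_smul, inv_mul_cancel₀ hne', one_smul]
      rw [h5, h4, smul_add, smul_smul, smul_smul]
      simp
    have htop : Submodule.span ℝ ({P3 *ᵥ c1, P3 *ᵥ c2} : Set (Fin 3 → ℝ)) = ⊤ :=
      Submodule.eq_top_iff'.2 hall
    classical
    have hf := finrank_span_finset_le_card (R := ℝ) ({P3 *ᵥ c1, P3 *ᵥ c2} : Finset (Fin 3 → ℝ))
    rw [Finset.coe_pair, Set.finrank, htop] at hf
    have hc := Finset.card_le_two (a := P3 *ᵥ c1) (b := P3 *ᵥ c2)
    simp at hf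
    omega
  refine ⟨r, hr, ?_⟩
  have hX : ∀ X, P3' *ᵥ X = r • (P3 *ᵥ X) := by
    intro X
    obtain ⟨u, hu⟩ := hu X
    obtain ⟨v, hv⟩ := hv X
    have : u • (P3 *ᵥ c1) + (-v) • (P3 *ᵥ c2) = 0 := by
      rw [hu, ← hrq] at hv
      have := add_left_cancel hv
      rw [this, neg_smul, add_neg_cancel]
    rw [hu, (hind _ _ this).1, zero_smul, add_zero]
  ext i j
  simpa using congrFun (hX (Pi.single j 1)) i

theorem surj_right {P : Matrix (Fin 3) (Fin 4) ℝ} (h : Surj P) (Q : Matrix (Fin 4) (Fin 4) ℝ)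
    (hQ : Q.det ≠ 0) : Surj (P * Q) := by
  intro v
  obtain ⟨X, hX⟩ := h v
  refine ⟨Q⁻¹ *ᵥ X, ?_⟩
  rw [mulVec_mulVec, Matrix.mul_assoc, mul_nonsing_inv _ (isUnit_iff_ne_zero.2 hQ), Matrix.mul_one, hX]

theorem Good.unscale {P P' : Matrix (Fin 3) (Fin 4) ℝ} {F : Matrix (Fin 3) (Fin 3) ℝ} {r q : ℝ}
    (hr : r ≠ 0) (hq : q ≠ 0) (h : Good (r • P) (q • P') F) : Good P P' F := by
  have := h.right 1 (by simp) r⁻¹ q⁻¹ (inv_ne_zero hr) (inv_ne_zero hq)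
  simpa [smul_smul, hr, hq] using this

theorem Good.unscale_left {P P' : Matrix (Fin 3) (Fin 4) ℝ} {F : Matrix (Fin 3) (Fin 3) ℝ} {r : ℝ}
    (hr : r ≠ 0) (h : Good (r • P) P' F) : Good P P' F := by
  apply Good.unscale hr one_ne_zero
  rwa [one_smul]

theorem epi {P P' : Matrix (Fin 3) (Fin 4) ℝ} {F : Matrix (Fin 3) (Fin 3) ℝ} {c : Fin 4 → ℝ}
    (h : Good P P' F) (hP : Surj P) (hc : P *ᵥ c = 0) : F *ᵥ (P' *ᵥ c) = 0 := by
  have : ∀ v, v ⬝ᵥ (F *ᵥ (P' *ᵥ c)) = 0 := by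
    intro v
    obtain ⟨X, rfl⟩ := hP v
    have := h.2.polar X c
    rwa [hc, zero_dotProduct, add_zero] at this
  exact dotProduct_self_eq_zero.1 (this _)

def Sol (n : ℕ) (F : Fin n → Fin n → Matrix (Fin 3) (Fin 3) ℝ) (s : Finset (Fin n))
    (P : Fin n → Matrix (Fin 3) (Fin 4) ℝ) : Prop :=
  (∀ i ∈ s, IsCamera (P i)) ∧ ∀ i ∈ s, ∀ j ∈ s, i ≠ j → Good (P i) (P j) (F i j)

theorem ne_zero_of_rank {F : Matrix (Fin 3) (Fin 3) ℝ} (h : F.rank = 2) : F ≠ 0 := by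
  rintro rfl
  simp at h

theorem sol_of_compat {n : ℕ} {F : Fin n → Fin n → Matrix (Fin 3) (Fin 3) ℝ}
    (hsym : ∀ i j, F j i = (F i j)ᵀ) (hrank : ∀ i j, i ≠ j → (F i j).rank = 2)
    {s : Finset (Fin n)} (h : CompatOn n F s) : ∃ P, Sol n F s P := by
  obtain ⟨P, lam, h1, h2⟩ := h
  refine ⟨P, h1, fun i hi j hj hij => ?_⟩
  rcases lt_or_gt_of_ne hij with h | h
  · exact good_of_psi (ne_zero_of_rank (hrank i j hij)) (h2 i j hi hj h).1 (h2 i j hi hj h).2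
  · rw [hsym j i]
    exact (good_of_psi (ne_zero_of_rank (hrank j i hij.symm)) (h2 j i hj hi h).1
      (h2 j i hj hi h).2).symm

theorem lam_of_sol {n : ℕ} {F : Fin n → Fin n → Matrix (Fin 3) (Fin 3) ℝ}
    (hrank : ∀ i j, i ≠ j → (F i j).rank = 2)
    {P : Fin n → Matrix (Fin 3) (Fin 4) ℝ} (h : Sol n F Finset.univ P) :
    ∃ lam : Fin n → Fin n → ℝ, ∀ i j, i < j → lam i j ≠ 0 ∧ lam i j • F i j = psi (P i) (P j) := by
  have : ∀ i j, ∃ l : ℝ, i < j → l ≠ 0 ∧ l • F i j = psi (P i) (P j) := by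
    intro i j
    by_cases hij : i < j
    · obtain ⟨l, hl⟩ := to_psi (hrank i j hij.ne) ((isCamera_iff _).1 (h.1 i (Finset.mem_univ _)))
        ((isCamera_iff _).1 (h.1 j (Finset.mem_univ _)))
        (h.2 i (Finset.mem_univ _) j (Finset.mem_univ _) hij.ne)
      exact ⟨l, fun _ => hl⟩
    · exact ⟨0, fun h => absurd h hij⟩
  choose lam hlam using this
  exact ⟨lam, hlam⟩

theorem transp {n : ℕ} {F : Fin n → Fin n → Matrix (Fin 3) (Fin 3) ℝ}
    (hrank : ∀ i j, i ≠ j → (F i j).rank = 2) {s : Finset (Fin n)}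
    {P : Fin n → Matrix (Fin 3) (Fin 4) ℝ} (h : Sol n F s P) {a b : Fin n} (ha : a ∈ s) (hb : b ∈ s)
    (hab : a ≠ b) {A B : Matrix (Fin 3) (Fin 4) ℝ} (hA : IsCamera A) (hB : IsCamera B)
    (g : Good A B (F a b)) : ∃ P', Sol n F s P' ∧ P' a = A ∧ P' b = B := by
  obtain ⟨Q, p, q, hQ, hp, hq, e1, e2⟩ := rigid (hrank a b hab) ((isCamera_iff _).1 (h.1 a ha))
    ((isCamera_iff _).1 (h.1 b hb)) ((isCamera_iff _).1 hA) ((isCamera_iff _).1 hB)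
    (h.2 a ha b hb hab) g
  let P' : Fin n → Matrix (Fin 3) (Fin 4) ℝ :=
    fun x => if x = a then A else if x = b then B else P x * Q
  have hP' : ∀ x, ∃ r : ℝ, r ≠ 0 ∧ P' x = r • (P x * Q) := by
    intro x
    by_cases hx : x = a
    · exact ⟨p, hp, by simp only [P', hx, if_true]; exact e1⟩
    · by_cases hy : x = b
      · exact ⟨q, hq, by simp only [P', hy, if_neg hab.symm, if_true]; exact e2⟩
      · exact ⟨1, one_ne_zero, by simp [P', hx, hy]⟩
  refine ⟨P', ⟨fun i hi => ?_, fun i hi j hj hij => ?_⟩, by simp [P'], by simp [P', hab.symm]⟩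
  · rw [isCamera_iff]
    obtain ⟨r, hr, e⟩ := hP' i
    rw [e]
    intro v
    obtain ⟨X, hX⟩ := surj_right ((isCamera_iff _).1 (h.1 i hi)) Q hQ (r⁻¹ • v)
    exact ⟨X, by rw [smul_mulVec, hX, smul_smul, mul_inv_cancel₀ hr, one_smul]⟩
  · obtain ⟨r, hr, e⟩ := hP' i
    obtain ⟨r', hr', e'⟩ := hP' j
    rw [e, e']
    exact (h.2 i hi j hj hij).right Q hQ r r' hr hr'

theorem Ind.swap12 {a b c : Fin 4 → ℝ} (h : Ind a b c) : Ind b a c := by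
  intro x y z e
  have := h y x z (by rw [← e]; abel)
  tauto

theorem Ind.swap23 {a b c : Fin 4 → ℝ} (h : Ind a b c) : Ind a c b := by
  intro x y z e
  have := h x z y (by rw [← e]; abel)
  tauto

theorem two_of {a b d c : Fin 4 → ℝ} (h : Ind a b d) (hc : ∀ r : ℝ, c ≠ r • a) :
    Ind a b c ∨ Ind a d c := by
  by_contra hne
  rw [not_or] at hne
  obtain ⟨h1, h2⟩ := hne
  unfold Ind at h1 h2
  push Not at h1 h2
  obtain ⟨x, y, z, e, hz⟩ := h1
  obtain ⟨x', y', z', e', hz'⟩ := h2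
  have z0 : z ≠ 0 := by
    rintro rfl
    have := h x y 0 (by rw [← e]; simp)
    exact hz this.1 this.2.1 rfl
  have z0' : z' ≠ 0 := by
    rintro rfl
    have := h x' 0 y' (by rw [← e']; simp)
    exact hz' this.1 this.2.2 rfl
  have := h (z' * x - z * x') (z' * y) (-(z * y')) (by
    have : z' • (x • a + y • b + z • c) - z • (x' • a + y' • d + z' • c) = 0 := by
      rw [e, e']; simp
    rw [← this]
    module)
  have y0 : y = 0 := (mul_eq_zero.1 this.2.1).resolve_left z0'
  subst y0
  apply hc (-(z⁻¹ * x))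
  have e3 : z⁻¹ • (x • a + (0:ℝ) • b + z • c) = 0 := by rw [e, smul_zero]
  rw [zero_smul, add_zero, smul_add, smul_smul, smul_smul, inv_mul_cancel₀ z0, one_smul] at e3
  rw [neg_smul]
  exact eq_neg_of_add_eq_zero_right e3

set_option maxHeartbeats 1000000 in
theorem part1 {n : ℕ} {F : Fin n → Fin n → Matrix (Fin 3) (Fin 3) ℝ} (hn : 4 ≤ n)
    (hsym : ∀ i j, F j i = (F i j)ᵀ)
    (hrank : ∀ i j, i ≠ j → (F i j).rank = 2)
    (e : Fin n → Fin n → (Fin 3 → ℝ))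
    (he : ∀ i j, i ≠ j → e i j ≠ 0 ∧ F i j *ᵥ e i j = 0)
    (h4 : ∀ s : Finset (Fin n), s.card = 4 → CompatOn n F s)
    (i j k : Fin n) (hji : j ≠ i) (hki : k ≠ i) (hne : ∀ c : ℝ, e j i ≠ c • e k i) :
    ∃ P, Sol n F Finset.univ P := by
  have hS : ∀ s : Finset (Fin n), s.card = 4 → ∃ P, Sol n F s P :=
    fun s hs => sol_of_compat hsym hrank (h4 s hs)
  have hjk : j ≠ k := by
    rintro rfl
    exact hne 1 (by simp)
  obtain ⟨T, hT⟩ : ∃ T : Finset (Fin n), T = {j, k, i} := ⟨_, rfl⟩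
  have hTc : T.card = 3 := by rw [hT]; exact Finset.card_eq_three.2 ⟨j, k, i, hjk, hji, hki, rfl⟩
  have hj : j ∈ T := by simp [hT]
  have hk : k ∈ T := by simp [hT]
  have hi : i ∈ T := by simp [hT]
  obtain ⟨U, hTU, hU⟩ := Finset.exists_superset_card_eq (s := T) (n := 4) (by omega) (by simpa using hn)
  obtain ⟨P0, hP0⟩ := hS U hU
  have cam0 : ∀ a ∈ T, IsCamera (P0 a) := fun a ha => hP0.1 a (hTU ha)
  have good0 : ∀ a ∈ T, ∀ b ∈ T, a ≠ b → Good (P0 a) (P0 b) (F a b) :=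
    fun a ha b hb => hP0.2 a (hTU ha) b (hTU hb)
  have : ∀ a, ∃ d, a ∈ T → d ≠ 0 ∧ P0 a *ᵥ d = 0 := by
    intro a
    by_cases ha : a ∈ T
    · obtain ⟨d, hd⟩ := exists_ker (cam0 a ha)
      exact ⟨d, fun _ => hd⟩
    · exact ⟨0, fun h => absurd h ha⟩
  choose d hd using this
  have hind : Ind (d j) (d k) (d i) := by
    have epj : ∀ a ∈ T, a ≠ i → P0 i *ᵥ d a ≠ 0 ∧ ∃ u : ℝ, e a i = u • (P0 i *ᵥ d a) := by
      intro a ha hai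
      have g := good0 a ha i hi hai
      have hnz : P0 i *ᵥ d a ≠ 0 := fun h0 => (hd a ha).1 (g.1 _ (hd a ha).2 h0)
      exact ⟨hnz, ker1 (F a i) (hrank a i hai) _ _ hnz
        (epi g ((isCamera_iff _).1 (cam0 a ha)) (hd a ha).2) (he a i hai).2⟩
    obtain ⟨nj, u, hu⟩ := epj j hj hji
    obtain ⟨nk, v, hv⟩ := epj k hk hki
    have hv0 : v ≠ 0 := by
      rintro rfl
      exact (he k i hki).1 (by rw [hv, zero_smul])
    intro x y z hxyz
    have h1 : x • (P0 i *ᵥ d j) + y • (P0 i *ᵥ d k) = 0 := by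
      have := congrArg (fun X => P0 i *ᵥ X) hxyz
      simpa [mulVec_add, mulVec_smul, (hd i hi).2] using this
    have hx : x = 0 := by
      by_contra hx
      have h2 : P0 i *ᵥ d j = (-(x⁻¹ * y)) • (P0 i *ᵥ d k) := by
        have e3 : x⁻¹ • (x • (P0 i *ᵥ d j) + y • (P0 i *ᵥ d k)) = 0 := by rw [h1, smul_zero]
        rw [smul_add, smul_smul, smul_smul, inv_mul_cancel₀ hx, one_smul] at e3
        rw [neg_smul]
        exact eq_neg_of_add_eq_zero_left e3
      apply hne (u * (-(x⁻¹ * y)) * v⁻¹)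
      rw [hu, hv, h2, smul_smul, smul_smul, mul_assoc _ v⁻¹, inv_mul_cancel₀ hv0, mul_one]
    subst hx
    rw [zero_smul, zero_add, smul_eq_zero] at h1
    have hy := h1.resolve_right nk
    subst hy
    simp only [zero_smul, zero_add, smul_eq_zero] at hxyz
    exact ⟨rfl, rfl, hxyz.resolve_right (hd i hi).1⟩
  have hex : ∀ l, ∃ A, IsCamera A ∧ (l ∈ T → A = P0 l) ∧
      ∀ a ∈ T, a ≠ l → Good (P0 a) A (F a l) := by
    intro l
    by_cases hl : l ∈ T
    · exact ⟨P0 l, cam0 l hl, fun _ => rfl, fun a ha hal => good0 a ha l hl hal⟩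
    · obtain ⟨P, hP⟩ := hS (insert l T) (by rw [Finset.card_insert_of_notMem hl, hTc])
      have mem : ∀ a ∈ T, a ∈ insert l T := fun a ha => Finset.mem_insert_of_mem ha
      have meml : l ∈ insert l T := Finset.mem_insert_self _ _
      obtain ⟨P', hP', ej, ek⟩ := transp hrank hP (mem j hj) (mem k hk) hjk (cam0 j hj) (cam0 k hk)
        (good0 j hj k hk hjk)
      have g1 := hP'.2 j (mem j hj) i (mem i hi) hji
      have g2 := hP'.2 k (mem k hk) i (mem i hi) hki
      rw [ej] at g1
      rw [ek] at g2
      obtain ⟨r, hr, ei⟩ := third (hrank j i hji) (hrank k i hki) (cam0 j hj) (cam0 k hk) (cam0 i hi)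
        (hP'.1 i (mem i hi)) (hd j hj).2 (hd k hk).2 (hd i hi).2 hind (good0 j hj i hi hji) g1
        (good0 k hk i hi hki) g2
      refine ⟨P' l, hP'.1 l meml, fun h => absurd h hl, fun a ha hal => ?_⟩
      have g := hP'.2 a (mem a ha) l meml hal
      rw [hT] at ha
      simp only [Finset.mem_insert, Finset.mem_singleton] at ha
      rcases ha with rfl | rfl | rfl
      · rwa [ej] at g
      · rwa [ek] at g
      · rw [ei] at g
        exact g.unscale_left hr
  choose P camP PT goodP using hex
  refine ⟨P, fun l _ => camP l, fun l _ m _ hlm => ?_⟩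
  by_cases hl : l ∈ T
  · rw [PT l hl]
    exact goodP m l hl hlm
  by_cases hm : m ∈ T
  · rw [PT m hm, hsym m l]
    exact (goodP l m hm hlm.symm).symm
  obtain ⟨cl, hcl0, hcl⟩ := exists_ker (camP l)
  obtain ⟨cm, hcm0, hcm⟩ := exists_ker (camP m)
  have np : ∀ a ∈ T, ∀ x, x ∉ T → ∀ c, c ≠ 0 → P x *ᵥ c = 0 → ∀ r : ℝ, c ≠ r • d a := by
    rintro a ha x hx c hc0 hc r rfl
    apply hc0
    apply (goodP x a ha (fun h => hx (h ▸ ha))).1 _ _ hc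
    rw [mulVec_smul, (hd a ha).2, smul_zero]
  have fin : ∀ a ∈ T, ∀ b ∈ T, a ≠ b → Ind (d a) (d b) cl → Ind (d a) (d b) cm →
      Good (P l) (P m) (F l m) := by
    intro a ha b hb hab il im
    have hal : a ≠ l := fun h => hl (h ▸ ha)
    have hbl : b ≠ l := fun h => hl (h ▸ hb)
    have ham : a ≠ m := fun h => hm (h ▸ ha)
    have hbm : b ≠ m := fun h => hm (h ▸ hb)
    obtain ⟨S, hSol⟩ := hS {a, b, l, m} (by
      rw [Finset.card_insert_of_notMem, Finset.card_insert_of_notMem, Finset.card_pair hlm] <;>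
          simp [hab, hal, hbl, ham, hbm])
    have ma : a ∈ ({a, b, l, m} : Finset (Fin n)) := by simp
    have mb : b ∈ ({a, b, l, m} : Finset (Fin n)) := by simp
    have ml : l ∈ ({a, b, l, m} : Finset (Fin n)) := by simp
    have mm : m ∈ ({a, b, l, m} : Finset (Fin n)) := by simp
    obtain ⟨P', hP', ea, eb⟩ := transp hrank hSol ma mb hab (cam0 a ha) (cam0 b hb)
        (good0 a ha b hb hab)
    have key : ∀ x ∈ ({a, b, l, m} : Finset (Fin n)), a ≠ x → b ≠ x → ∀ c, P x *ᵥ c = 0 →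
        Ind (d a) (d b) c → ∃ r : ℝ, r ≠ 0 ∧ P' x = r • P x := by
      intro x hx hax hbx c hc ic
      have g1 := hP'.2 a ma x hx hax
      have g2 := hP'.2 b mb x hx hbx
      rw [ea] at g1
      rw [eb] at g2
      exact third (hrank a x hax) (hrank b x hbx) (cam0 a ha) (cam0 b hb) (camP x)
        (hP'.1 x hx) (hd a ha).2 (hd b hb).2 hc ic (goodP x a ha hax) g1 (goodP x b hb hbx) g2
    obtain ⟨r, hr, er⟩ := key l ml hal hbl cl hcl il
    obtain ⟨q, hq, eq⟩ := key m mm ham hbm cm hcm im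
    have g := hP'.2 l ml m mm hlm
    rw [er, eq] at g
    exact g.unscale hr hq
  have tw : ∀ x, x ∉ T → ∀ c, c ≠ 0 → P x *ᵥ c = 0 →
      (Ind (d j) (d k) c ∨ Ind (d j) (d i) c) ∧ (Ind (d j) (d k) c ∨ Ind (d k) (d i) c) ∧
      (Ind (d j) (d i) c ∨ Ind (d k) (d i) c) := by
    intro x hx c hc0 hc
    have t1 := two_of hind (np j hj x hx c hc0 hc)
    have t2 := two_of hind.swap12 (np k hk x hx c hc0 hc)
    have t3 := two_of hind.swap23.swap12 (np i hi x hx c hc0 hc)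
    exact ⟨t1, t2.imp Ind.swap12 id, t3.imp Ind.swap12 Ind.swap12⟩
  have t1 := tw l hl cl hcl0 hcl
  have t2 := tw m hm cm hcm0 hcm
  have f1 := fin j hj k hk hjk
  have f2 := fin j hj i hi hji
  have f3 := fin k hk i hi hki
  clear fin tw np goodP PT camP hind hd
  rcases t1 with ⟨a | a, b | b, c | c⟩ <;> rcases t2 with ⟨a' | a', b' | b', c' | c'⟩ <;>
    first
      | exact f1 ‹_› ‹_›
      | exact f2 ‹_› ‹_›
      | exact f3 ‹_› ‹_›

theorem frames {n : ℕ} {F : Fin n → Fin n → Matrix (Fin 3) (Fin 3) ℝ} (hn : 4 ≤ n)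
    (hsym : ∀ i j, F j i = (F i j)ᵀ)
    (hrank : ∀ i j, i ≠ j → (F i j).rank = 2)
    (e : Fin n → Fin n → (Fin 3 → ℝ))
    (he : ∀ i j, i ≠ j → e i j ≠ 0 ∧ F i j *ᵥ e i j = 0)
    (hpar : ∀ i j k : Fin n, j ≠ i → k ≠ i → ∃ c : ℝ, e j i = c • e k i)
    (h3 : ∀ s : Finset (Fin n), s.card = 3 → ∃ P, Sol n F s P) :
    ∃ B : Fin n → Matrix (Fin 3) (Fin 3) ℝ, (∀ i, (B i).det ≠ 0) ∧
      ∀ i j, i ≠ j → ∃ g : ℝ, (B i)ᵀ * F i j * B j = g • J3 := by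
  let o : Fin n := ⟨0, by omega⟩
  let p : Fin n := ⟨1, by omega⟩
  have hpo : p ≠ o := by simp [o, p]
  have hkill : ∀ i j k, j ≠ i → k ≠ i → F j i *ᵥ e k i = 0 := by
    intro i j k hj hk
    obtain ⟨c, hc⟩ := hpar i k j hk hj
    rw [hc, mulVec_smul, (he j i hj).2, smul_zero]
  obtain ⟨B0, hB0, hB0e⟩ := compl3 (e p o) (he p o hpo).1
  have hex : ∀ i, ∃ B : Matrix (Fin 3) (Fin 3) ℝ, B.det ≠ 0 ∧ (i = o → B = B0) ∧
      (i ≠ o → B0ᵀ * F o i * B = J3) := by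
    intro i
    by_cases hi : i = o
    · exact ⟨B0, hB0, fun _ => rfl, fun h => absurd hi h⟩
    · obtain ⟨B, h1, h2⟩ := nf1 (F o i) B0 (hrank o i (Ne.symm hi)) hB0 (by
        rw [hB0e, ← hsym o i]
        exact hkill o i p hi hpo)
      exact ⟨B, h1, fun h => absurd h hi, fun _ => h2⟩
  choose B hB hBo hBJ using hex
  have J0 : J3 *ᵥ ![0,0,1] = 0 := by
    ext i; fin_cases i <;> simp [J3, mulVec, dotProduct, Fin.sum_univ_succ]
  have Bker : ∀ i, i ≠ o → F o i *ᵥ (B i *ᵥ ![0,0,1]) = 0 := by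
    intro i hi
    have h := J0
    rw [← hBJ i hi, ← mulVec_mulVec, ← mulVec_mulVec] at h
    by_contra hne
    refine hB0 ?_
    rw [← det_transpose]
    exact exists_mulVec_eq_zero_iff.1 ⟨_, hne, h⟩
  have Bker' : ∀ i j, i ≠ o → j ≠ i → F j i *ᵥ (B i *ᵥ ![0,0,1]) = 0 := by
    intro i j hi hj
    obtain ⟨c, hc⟩ := ker1 (F o i) (hrank o i (Ne.symm hi)) _ _ (he o i (Ne.symm hi)).1
      (he o i (Ne.symm hi)).2 (Bker i hi)
    rw [hc, mulVec_smul, hkill i j o hj (Ne.symm hi), smul_zero]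
  refine ⟨B, hB, fun i j hij => ?_⟩
  by_cases hi : i = o
  · subst hi
    rw [hBo o rfl]
    exact ⟨1, by rw [hBJ j (Ne.symm hij), one_smul]⟩
  by_cases hj : j = o
  · subst hj
    rw [hBo o rfl]
    refine ⟨-1, ?_⟩
    have := congrArg transpose (hBJ i hi)
    rw [transpose_mul, transpose_mul, transpose_transpose, ← hsym o i, ← Matrix.mul_assoc] at this
    rw [this]
    ext a b
    fin_cases a <;> fin_cases b <;> simp [J3]
  obtain ⟨P, hP⟩ := h3 {o, i, j} (Finset.card_eq_three.2 ⟨o, i, j, Ne.symm hi, Ne.symm hj, hij, rfl⟩)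
  have mo : o ∈ ({o, i, j} : Finset (Fin n)) := by simp
  have mi : i ∈ ({o, i, j} : Finset (Fin n)) := by simp
  have mj : j ∈ ({o, i, j} : Finset (Fin n)) := by simp
  have so := (isCamera_iff _).1 (hP.1 o mo)
  have si := (isCamera_iff _).1 (hP.1 i mi)
  have sj := (isCamera_iff _).1 (hP.1 j mj)
  have goi := hP.2 o mo i mi (Ne.symm hi)
  have goj := hP.2 o mo j mj (Ne.symm hj)
  have gij := hP.2 i mi j mj hij
  obtain ⟨Po, eo⟩ := factor (P o) hB0
  obtain ⟨Pi, ei⟩ := factor (P i) (hB i)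
  obtain ⟨Pj, ej⟩ := factor (P j) (hB j)
  rw [eo] at so goi goj
  rw [ei] at si goi gij
  rw [ej] at sj goj gij
  have so := surj_left so hB0
  have si := surj_left si (hB i)
  have sj := surj_left sj (hB j)
  have goi := goi.left
  have goj := goj.left
  have gij := gij.left
  rw [hBJ i hi] at goi
  rw [hBJ j hj] at goj
  obtain ⟨l, hl, hli⟩ := relJ goi.2 so si
  obtain ⟨m, hm, hmj⟩ := relJ goj.2 so sj
  have k1 : ((B i)ᵀ * F i j * B j) *ᵥ ![0,0,1] = 0 := by
    rw [← mulVec_mulVec, ← mulVec_mulVec, Bker' j i hj hij, mulVec_zero]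
  have k2 : ((B i)ᵀ * F i j * B j)ᵀ *ᵥ ![0,0,1] = 0 := by
    rw [transpose_mul, transpose_mul, transpose_transpose, ← hsym i j, ← mulVec_mulVec,
      ← mulVec_mulVec, Bker' i j hi (Ne.symm hij), mulVec_zero]
  have gr := gij.2
  generalize (B i)ᵀ * F i j * B j = G at k1 k2 gr
  have c2 : ∀ a, G a 2 = 0 := fun a => by
    simpa [mulVec, dotProduct, Fin.sum_univ_succ] using congrFun k1 a
  have r2 : ∀ a, G 2 a = 0 := fun a => by
    simpa [mulVec, dotProduct, Fin.sum_univ_succ] using congrFun k2 a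
  have key : ∀ a b : ℝ, a * a * G 0 0 + a * b * (G 0 1 + G 1 0) + b * b * G 1 1 = 0 := by
    intro a b
    obtain ⟨X, hX⟩ := so ![a, b, 0]
    have h := gr X
    simp only [mulVec, dotProduct, Fin.sum_univ_three, c2, r2] at h
    have i0 := (hli X).1
    have i1 := (hli X).2
    have j0 := (hmj X).1
    have j1 := (hmj X).2
    rw [hX] at i0 i1 j0 j1
    simp at i0 i1 j0 j1
    simp only [mulVec, dotProduct] at i0 i1 j0 j1
    rw [i0, i1, j0, j1] at h
    apply mul_left_cancel₀ (mul_ne_zero hl hm)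
    linear_combination h
  have q1 := key 1 0
  have q2 := key 0 1
  have q3 := key 1 1
  simp at q1 q2
  simp [q1, q2] at q3
  have q4 : G 1 0 = - G 0 1 := by linarith
  refine ⟨G 0 1, ?_⟩
  ext a b
  fin_cases a <;> fin_cases b <;> simp [J3, q1, q2, q4, c2, r2]

theorem part2 {n : ℕ} {F : Fin n → Fin n → Matrix (Fin 3) (Fin 3) ℝ} (hn : 4 ≤ n)
    (hsym : ∀ i j, F j i = (F i j)ᵀ)
    (hrank : ∀ i j, i ≠ j → (F i j).rank = 2)
    (e : Fin n → Fin n → (Fin 3 → ℝ))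
    (he : ∀ i j, i ≠ j → e i j ≠ 0 ∧ F i j *ᵥ e i j = 0)
    (hpar : ∀ i j k : Fin n, j ≠ i → k ≠ i → ∃ c : ℝ, e j i = c • e k i)
    (h3 : ∀ s : Finset (Fin n), s.card = 3 → ∃ P, Sol n F s P) :
    ∃ P, Sol n F Finset.univ P ∧ ∃ c : Fin n → (Fin 4 → ℝ),
            (∀ i, c i ≠ 0 ∧ P i *ᵥ c i = 0) ∧
            Module.finrank ℝ (Submodule.span ℝ (Set.range c)) ≤ 2 := by
  obtain ⟨B, hB, hG⟩ := frames hn hsym hrank e he hpar h3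
  let E : Fin n → Matrix (Fin 3) (Fin 4) ℝ := fun i => !![1,0,0,0;0,1,0,0;0,0,1,((i:ℕ):ℝ)]
  have hE : ∀ i X, E i *ᵥ X = ![X 0, X 1, X 2 + (i:ℕ) * X 3] := by
    intro i X
    ext a
    fin_cases a <;> simp [E, mulVec, dotProduct, Fin.sum_univ_four]
  have Binj : ∀ i v, B i *ᵥ v = 0 → v = 0 := by
    intro i v h
    by_contra hne
    exact hB i (exists_mulVec_eq_zero_iff.1 ⟨v, hne, h⟩)
  refine ⟨fun i => B i * E i, ⟨fun i _ => ?_, fun i _ j _ hij => ⟨fun X h1 h2 => ?_, fun X => ?_⟩⟩,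
    fun i => ![0, 0, -((i:ℕ):ℝ), 1], fun i => ⟨fun h => ?_, ?_⟩, ?_⟩
  · rw [isCamera_iff]
    apply surj_left' _ (hB i)
    intro v
    refine ⟨![v 0, v 1, v 2, 0], ?_⟩
    rw [hE]
    ext a
    fin_cases a <;> simp
  · rw [← mulVec_mulVec] at h1 h2
    have h1 := Binj _ _ h1
    have h2 := Binj _ _ h2
    rw [hE] at h1 h2
    have x0 : X 0 = 0 := congrFun h1 0
    have x1 : X 1 = 0 := congrFun h1 1
    have x2 : X 2 + (i:ℕ) * X 3 = 0 := congrFun h1 2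
    have x2' : X 2 + (j:ℕ) * X 3 = 0 := congrFun h2 2
    have hne : ((i:ℕ):ℝ) - (j:ℕ) ≠ 0 := by
      rw [sub_ne_zero]
      intro h
      exact hij (Fin.ext (Nat.cast_injective h))
    have x3 : X 3 = 0 := by
      have : (((i:ℕ):ℝ) - (j:ℕ)) * X 3 = 0 := by linarith
      exact (mul_eq_zero.1 this).resolve_left hne
    have x2'' : X 2 = 0 := by rw [x3] at x2; linarith
    ext a
    fin_cases a <;> assumption
  · obtain ⟨g, hg⟩ := hG i j hij
    have h : (E i *ᵥ X) ⬝ᵥ (((B i)ᵀ * F i j * B j) *ᵥ (E j *ᵥ X)) = 0 := by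
      rw [hg, smul_mulVec, dotProduct_smul, J_apply, hE, hE]
      simp
      right
      ring
    rw [← mulVec_mulVec, ← mulVec_mulVec, mulVec_transpose, dotProduct_comm, ← dotProduct_mulVec,
      dotProduct_comm] at h
    rw [← mulVec_mulVec, ← mulVec_mulVec]
    exact h
  · have := congrFun h 3
    simp at this
  · rw [← mulVec_mulVec, hE]
    refine (congrArg (fun v => B i *ᵥ v) ?_).trans (mulVec_zero (B i))
    ext a
    fin_cases a <;> simp
  · classical
    have hle : Submodule.span ℝ (Set.range fun i : Fin n => (![0, 0, -((i:ℕ):ℝ), 1] : Fin 4 → ℝ)) ≤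
        Submodule.span ℝ (({![0,0,1,0], ![0,0,0,1]} : Finset (Fin 4 → ℝ)) : Set (Fin 4 → ℝ)) := by
      rw [Submodule.span_le]
      rintro _ ⟨i, rfl⟩
      rw [Finset.coe_pair, SetLike.mem_coe, Submodule.mem_span_pair]
      refine ⟨-((i:ℕ):ℝ), 1, ?_⟩
      ext a
      fin_cases a <;> simp
    refine (Submodule.finrank_mono hle).trans ?_
    exact (finrank_span_finset_le_card (R := ℝ) _).trans Finset.card_le_two

/-- quadruple-wise compatibility implies global compatibility; in the
all-collinear-epipoles case, triple-wise compatibility suffices and there is a solution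
with all camera centers on a line.  Here `e i j` denotes the epipole `e_j^i`. -/
theorem stmt16 (n : ℕ) (hn : 4 ≤ n)
    (F : Fin n → Fin n → Matrix (Fin 3) (Fin 3) ℝ)
    (hsym : ∀ i j, F j i = (F i j)ᵀ)
    (hrank : ∀ i j, i ≠ j → (F i j).rank = 2)
    (e : Fin n → Fin n → (Fin 3 → ℝ))
    (he : ∀ i j, i ≠ j → e i j ≠ 0 ∧ F i j *ᵥ e i j = 0) :
    ((∀ s : Finset (Fin n), s.card = 4 → CompatOn n F s) →
        CompatOn n F Finset.univ) ∧
      ((∀ i j k : Fin n, j ≠ i → k ≠ i → ∃ c : ℝ, e j i = c • e k i) →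
        (∀ s : Finset (Fin n), s.card = 3 → CompatOn n F s) →
        ∃ (P : Fin n → Matrix (Fin 3) (Fin 4) ℝ) (lam : Fin n → Fin n → ℝ),
          (∀ i, IsCamera (P i)) ∧
          (∀ i j, i < j → lam i j ≠ 0 ∧ lam i j • F i j = psi (P i) (P j)) ∧
          ∃ c : Fin n → (Fin 4 → ℝ),
            (∀ i, c i ≠ 0 ∧ P i *ᵥ c i = 0) ∧
            Module.finrank ℝ (Submodule.span ℝ (Set.range c)) ≤ 2) := by
  constructor
  · intro h4
    have main : ∃ P, Sol n F Finset.univ P := by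
      by_cases hpar : ∀ i j k : Fin n, j ≠ i → k ≠ i → ∃ c : ℝ, e j i = c • e k i
      · obtain ⟨P, hP, _⟩ := part2 hn hsym hrank e he hpar (fun s hs => by
          obtain ⟨U, hsU, hU⟩ := Finset.exists_superset_card_eq (s := s) (n := 4) (by omega)
            (by simpa using hn)
          obtain ⟨P, hP⟩ := sol_of_compat hsym hrank (h4 U hU)
          exact ⟨P, fun i hi => hP.1 i (hsU hi),
            fun i hi j hj hij => hP.2 i (hsU hi) j (hsU hj) hij⟩)
        exact ⟨P, hP⟩
      · push Not at hpar
        obtain ⟨i, j, k, hj, hk, hne⟩ := hpar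
        exact part1 hn hsym hrank e he h4 i j k hj hk hne
    obtain ⟨P, hP⟩ := main
    obtain ⟨lam, hlam⟩ := lam_of_sol hrank hP
    exact ⟨P, lam, hP.1, fun i j _ _ hij => hlam i j hij⟩
  · intro hpar h3
    obtain ⟨P, hP, hc⟩ := part2 hn hsym hrank e he hpar
      (fun s hs => sol_of_compat hsym hrank (h3 s hs))
    obtain ⟨lam, hlam⟩ := lam_of_sol hrank hP
    exact ⟨P, lam, fun i => hP.1 i (Finset.mem_univ _), hlam, hc⟩
end
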